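/- arXiv:1703.01207 — 2 statements merged into one kernel-verified Lean document; each statement's English description precedes it below -/
import Mathlib

section
/- Let (m_n) be a sequence of integers with 0.98·C(n,2) ≤ m_n < C(n,2), and let G ∼ 𝒢(n, m_n) be a uniformly random simple graph on {1,…,n} with exactly m_n edges. Then asymptotically almost surely G has a legal system. -/
open SimpleGraph

noncomputable def chi {V : Type*} (A : Set V) : V → ZMod 2 :=
  A.indicator 1

def LegalState {V : Type*} (G : SimpleGraph V) (S : Set V) : Prop :=
  S.Nonempty ∧ Sᶜ.Nonempty ∧ (G.induce S).Connected ∧ (G.induce Sᶜ).Connected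

def IsMove {V : Type*} (G : SimpleGraph V) (v : V) (M : Set V) : Prop :=
  v ∈ M ∧ ∀ u ∈ M, ¬ G.Adj v u

noncomputable def actSet {V : Type*} (f : V → ZMod 2) (S : Set V) : Set V :=
  {x | f x + chi S x = 1}

def IsLegalSystem {V : Type*} (G : SimpleGraph V) (S : Set V) (M : V → Set V) : Prop :=
  (∀ v, IsMove G v (M v)) ∧
    ∀ g ∈ AddSubgroup.closure (Set.range fun v => chi (M v)),
      LegalState G (actSet g S)

def HasLegalSystem {V : Type*} (G : SimpleGraph V) : Prop :=
  ∃ (S : Set V) (M : V → Set V), IsLegalSystem G S M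

open Filter

open Classical in
lemma aux_invol {n : ℕ} (G : SimpleGraph (Fin n)) :
    ∃ σ : Fin n → Fin n, (∀ v, σ (σ v) = v) ∧ (∀ v, ¬ G.Adj v (σ v)) ∧
      ∀ u v, σ u = u → σ v = v → u ≠ v → G.Adj u v := by
  let P : Finset (Fin n → Fin n) :=
    Finset.univ.filter fun σ => (∀ v, σ (σ v) = v) ∧ (∀ v, ¬ G.Adj v (σ v))
  have hP : P.Nonempty := ⟨id, by simp [P]⟩
  obtain ⟨σ, hσ, hmax⟩ := P.exists_max_image
    (fun σ => (Finset.univ.filter fun v => σ v ≠ v).card) hP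
  simp only [P, Finset.mem_filter, Finset.mem_univ, true_and] at hσ hmax
  refine ⟨σ, hσ.1, hσ.2, ?_⟩
  intro u v hu hv huv
  by_contra hadj
  let τ : Fin n → Fin n := fun x => if x = u then v else if x = v then u else σ x
  have h1 : ∀ x, τ (τ x) = x := by
    intro x
    have := hσ.1 x
    simp only [τ]
    grind
  have h2 : ∀ x, ¬ G.Adj x (τ x) := by
    intro x
    have := hσ.2 x
    have hs := G.adj_comm u v
    simp only [τ]
    grind
  have h3 := hmax τ ⟨h1, h2⟩
  have : (Finset.univ.filter fun v => σ v ≠ v) ⊂ (Finset.univ.filter fun v => τ v ≠ v) := by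
    rw [Finset.ssubset_iff_of_subset]
    · refine ⟨u, ?_, ?_⟩
      · simp [τ, huv.symm]
      · simp [hu]
    · intro x
      simp only [Finset.mem_filter, Finset.mem_univ, true_and, τ]
      grind
  exact absurd (Finset.card_lt_card this) (not_lt.mpr h3)

lemma aux_conn {V : Type*} (G : SimpleGraph V) (T : Set V) (hT : T.Nonempty)
    (h : ∀ x ∈ T, ∀ y ∈ T, x ≠ y → ¬ G.Adj x y → ∃ z ∈ T, G.Adj x z ∧ G.Adj z y) :
    (G.induce T).Connected := by
  have : Nonempty T := hT.to_subtype
  refine ⟨?_⟩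
  rintro ⟨x, hx⟩ ⟨y, hy⟩
  by_cases hxy : x = y
  · subst hxy; exact Reachable.refl _
  by_cases ha : G.Adj x y
  · exact Adj.reachable (G := G.induce T) (by simpa using ha)
  obtain ⟨z, hz, h1, h2⟩ := h x hx y hy hxy ha
  have e1 : (G.induce T).Adj ⟨x, hx⟩ ⟨z, hz⟩ := by simpa using h1
  have e2 : (G.induce T).Adj ⟨z, hz⟩ ⟨y, hy⟩ := by simpa using h2
  exact e1.reachable.trans e2.reachable

open Classical in
lemma aux_state {n : ℕ} (G : SimpleGraph (Fin n)) (D : ℕ)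
    (hD : ∀ v, Gᶜ.degree v ≤ D) (hh : 1 ≤ Gᶜ.edgeFinset.card)
    (h : D ≤ 1 ∨ 4 * D ^ 2 < Gᶜ.edgeFinset.card)
    (σ : Fin n → Fin n) (h1 : ∀ v, σ (σ v) = v) (h2 : ∀ v, ¬ G.Adj v (σ v))
    (h3 : ∀ u v, σ u = u → σ v = v → u ≠ v → G.Adj u v)
    (T : Set (Fin n)) (hT : ∀ v, σ v ≠ v → (v ∈ T ↔ σ v ∉ T)) :
    T.Nonempty ∧ (G.induce T).Connected := by
  have hne : T.Nonempty := by
    obtain ⟨e, he⟩ := Finset.card_pos.mp hh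
    induction e with | _ u v
    rw [mem_edgeFinset, mem_edgeSet, compl_adj] at he
    have : σ u ≠ u ∨ σ v ≠ v := by
      by_contra! hc
      exact he.2 (h3 u v hc.1 hc.2 he.1)
    have key : ∀ w, σ w ≠ w → T.Nonempty := by
      intro w hw
      by_cases hwT : w ∈ T
      · exact ⟨w, hwT⟩
      · exact ⟨σ w, by by_contra hc; exact hwT ((hT w hw).2 hc)⟩
    rcases this with h | h
    · exact key _ h
    · exact key _ h
  refine ⟨hne, aux_conn G T hne ?_⟩
  intro x hx y hy hxy hadj
  have hc : Gᶜ.Adj x y := by rw [compl_adj]; exact ⟨hxy, hadj⟩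
  rcases h with h | h
  · exfalso
    have key : ∀ x ∈ T, ∀ y ∈ T, Gᶜ.Adj x y → σ x = x := by
      intro x hx y hy hc
      by_contra hs
      have hd := (hD x).trans h
      rw [← card_neighborFinset_eq_degree, Finset.card_le_one] at hd
      have := hd y (by simpa using hc) (σ x) (by
        rw [mem_neighborFinset, compl_adj]; exact ⟨fun h => hs h.symm, h2 x⟩)
      subst this
      exact (hT x hs).1 hx hy
    exact hadj (h3 x y (key x hx y hy hc) (key y hy x hx hc.symm) hxy)
  · let Mv : Finset (Fin n) := Finset.univ.filter fun v => σ v ≠ v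
    let T' : Finset (Fin n) := Finset.univ.filter fun v => v ∈ T
    have a1 : Gᶜ.edgeFinset.card ≤ Mv.card * D := by
      have : Gᶜ.edgeFinset ⊆ Mv.biUnion fun v => Gᶜ.incidenceFinset v := by
        intro e he
        induction e with | _ u v
        rw [Finset.mem_biUnion]
        have he' := he
        rw [mem_edgeFinset, mem_edgeSet, compl_adj] at he'
        have : σ u ≠ u ∨ σ v ≠ v := by
          by_contra! hc
          exact he'.2 (h3 u v hc.1 hc.2 he'.1)
        rw [mem_edgeFinset] at he
        rcases this with h | h
        · exact ⟨u, by simp [Mv, h], by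
            rw [mem_incidenceFinset]; exact ⟨he, by simp⟩⟩
        · exact ⟨v, by simp [Mv, h], by
            rw [mem_incidenceFinset]; exact ⟨he, by simp⟩⟩
      refine (Finset.card_le_card this).trans (Finset.card_biUnion_le_card_mul _ _ _ ?_)
      intro v _
      rw [card_incidenceFinset_eq_degree]
      exact hD v
    have a2 : Mv.card ≤ 2 * T'.card := by
      have : Mv ⊆ T' ∪ T'.image σ := by
        intro v hv
        simp only [Mv, T', Finset.mem_filter, Finset.mem_univ, true_and, Finset.mem_union,
          Finset.mem_image] at hv ⊢
        by_cases hvT : v ∈ T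
        · exact Or.inl hvT
        · exact Or.inr ⟨σ v, by by_contra hc; exact hvT ((hT v hv).2 hc), h1 v⟩
      have := Finset.card_le_card this
      have b := Finset.card_union_le T' (T'.image σ)
      have c := Finset.card_image_le (s := T') (f := σ)
      omega
    have a3 : 2 * D < T'.card := by
      by_contra! hc
      nlinarith
    have a4 : (Gᶜ.neighborFinset x ∪ Gᶜ.neighborFinset y).card < T'.card := by
      have := Finset.card_union_le (Gᶜ.neighborFinset x) (Gᶜ.neighborFinset y)
      rw [card_neighborFinset_eq_degree, card_neighborFinset_eq_degree] at this
      have := hD x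
      have := hD y
      omega
    obtain ⟨z, hz, hz'⟩ := Finset.exists_mem_notMem_of_card_lt_card a4
    refine ⟨z, by simpa [T'] using hz, ?_⟩
    simp only [Finset.mem_union, mem_neighborFinset, not_or] at hz'
    have zx : x ≠ z := by rintro rfl; exact hz'.2 hc.symm
    have zy : y ≠ z := by rintro rfl; exact hz'.1 hc
    rw [compl_adj, compl_adj] at hz'
    constructor
    · by_contra hq; exact hz'.1 ⟨zx, hq⟩
    · by_contra hq; exact hz'.2 ⟨zy, fun h => hq h.symm⟩

open Classical in
lemma aux_det {n : ℕ} (G : SimpleGraph (Fin n)) (D : ℕ)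
    (hD : ∀ v, Gᶜ.degree v ≤ D) (hh : 1 ≤ Gᶜ.edgeFinset.card)
    (h : D ≤ 1 ∨ 4 * D ^ 2 < Gᶜ.edgeFinset.card) : HasLegalSystem G := by
  obtain ⟨σ, h1, h2, h3⟩ := aux_invol G
  refine ⟨{v | v < σ v}, fun v => {v, σ v}, ?_, ?_⟩
  · intro v
    refine ⟨by simp, ?_⟩
    rintro u (rfl | rfl)
    · exact G.loopless.irrefl _
    · exact h2 v
  intro g hg
  have hinv : ∀ v, g (σ v) = g v := by
    induction hg using AddSubgroup.closure_induction with
    | mem x hx =>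
      obtain ⟨w, rfl⟩ := hx
      intro v
      have : σ v ∈ ({w, σ w} : Set (Fin n)) ↔ v ∈ ({w, σ w} : Set (Fin n)) := by
        have := h1 v
        have := h1 w
        simp only [Set.mem_insert_iff, Set.mem_singleton_iff]
        grind
      simp only [chi, Set.indicator, this]
      split_ifs <;> rfl
    | zero => intro v; rfl
    | add x y _ _ hx hy => intro v; simp [hx v, hy v]
    | neg x _ hx => intro v; simp [hx v]
  have z2 : ∀ a : ZMod 2, a + 1 = 1 ↔ ¬ (a = 1) := by decide
  have hT : ∀ v, σ v ≠ v → (v ∈ actSet g {v | v < σ v} ↔ σ v ∉ actSet g {v | v < σ v}) := by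
    intro v hv
    simp only [actSet, Set.mem_ofPred_eq, hinv v, chi, Set.indicator, h1 v, Pi.one_apply]
    rcases lt_or_gt_of_ne hv with h | h
    · simp only [h, not_lt.mpr h.le, if_true, if_false, add_zero, z2, not_not]
    · simp only [h, not_lt.mpr h.le, if_true, if_false, add_zero, z2]
  have s1 := aux_state G D hD hh h σ h1 h2 h3 _ hT
  have s2 := aux_state G D hD hh h σ h1 h2 h3 (actSet g {v | v < σ v})ᶜ (by
    intro v hv
    have := hT v hv
    simp only [Set.mem_compl_iff]
    tauto)
  exact ⟨s1.1, s2.1, s1.2, s2.2⟩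

lemma aux_desc (N h : ℕ) (hN : h ≤ N) (j : ℕ) :
    h.descFactorial j * N ^ j ≤ N.descFactorial j * h ^ j := by
  induction j with
  | zero => simp
  | succ j ih =>
    rw [Nat.descFactorial_succ, Nat.descFactorial_succ, pow_succ, pow_succ]
    have : (h - j) * N ≤ (N - j) * h := by
      rw [Nat.sub_mul, Nat.sub_mul, mul_comm h N]
      exact Nat.sub_le_sub_left (Nat.mul_le_mul_left _ hN) _
    calc (h - j) * h.descFactorial j * (N ^ j * N)
        = ((h - j) * N) * (h.descFactorial j * N ^ j) := by ring
      _ ≤ ((N - j) * h) * (N.descFactorial j * h ^ j) := Nat.mul_le_mul this ih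
      _ = _ := by ring

open Classical in
lemma aux_count {α : Type*} (E I : Finset α) (hI : I ⊆ E) (h d j : ℕ) :
    ((E.powersetCard h).filter fun T => d ≤ (T ∩ I).card).card * d.choose j * E.card.choose j
      ≤ I.card.choose j * (E.card.choose h * h.choose j) := by
  have e1 : ((E.powersetCard h).filter fun T => d ≤ (T ∩ I).card).card * d.choose j ≤
      ∑ T ∈ E.powersetCard h, (T ∩ I).card.choose j := by
    rw [← smul_eq_mul]
    refine (Finset.card_nsmul_le_sum _ (fun T => (T ∩ I).card.choose j) _ ?_).trans
      (Finset.sum_le_sum_of_subset (Finset.filter_subset _ _))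
    intro T hT
    exact Nat.choose_le_choose _ (Finset.mem_filter.1 hT).2
  have e2 : ∑ T ∈ E.powersetCard h, (T ∩ I).card.choose j =
      ∑ J ∈ I.powersetCard j, ((E.powersetCard h).filter (J ⊆ ·)).card := by
    have : ∀ T : Finset α, (T ∩ I).card.choose j =
        ((I.powersetCard j).filter (· ⊆ T)).card := by
      intro T
      rw [← Finset.card_powersetCard]
      congr 1
      ext J
      simp only [Finset.mem_powersetCard, Finset.mem_filter, Finset.subset_inter_iff]
      tauto
    simp_rw [this, Finset.card_filter]
    exact Finset.sum_comm
  have e3 : ∀ J ∈ I.powersetCard j, ((E.powersetCard h).filter (J ⊆ ·)).card * E.card.choose j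
      ≤ E.card.choose h * h.choose j := by
    intro J hJ
    rw [Finset.mem_powersetCard] at hJ
    by_cases hj : j ≤ h
    · rw [Finset.card_filter_powersetCard_subset _ _ _ (hJ.1.trans hI) (by rw [hJ.2]; exact hj), hJ.2,
        Nat.choose_mul hj, mul_comm]
    · have : ((E.powersetCard h).filter (J ⊆ ·)) = ∅ := by
        rw [Finset.filter_eq_empty_iff]
        intro T hT hs
        have := Finset.card_le_card hs
        rw [(Finset.mem_powersetCard.1 hT).2, hJ.2] at this
        exact hj this
      rw [this]; simp
  calc _ ≤ (∑ J ∈ I.powersetCard j, ((E.powersetCard h).filter (J ⊆ ·)).card) * E.card.choose j :=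
        Nat.mul_le_mul_right _ (e1.trans e2.le)
    _ = ∑ J ∈ I.powersetCard j, ((E.powersetCard h).filter (J ⊆ ·)).card * E.card.choose j := by
        rw [Finset.sum_mul]
    _ ≤ (I.powersetCard j).card • (E.card.choose h * h.choose j) :=
        Finset.sum_le_card_nsmul _ _ _ e3
    _ = _ := by rw [Finset.card_powersetCard, smul_eq_mul]

open Classical in
lemma aux_count2 {α : Type*} (E I : Finset α) (hI : I ⊆ E) (h d j : ℕ) (hh : h ≤ E.card)
    (hj : j ≤ E.card) :
    ((E.powersetCard h).filter fun T => d ≤ (T ∩ I).card).card * (E.card * (d + 1 - j)) ^ j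
      ≤ E.card.choose h * (I.card * h) ^ j := by
  have h0 := aux_count E I hI h d j
  set c := ((E.powersetCard h).filter fun T => d ≤ (T ∩ I).card).card
  have hpos : 0 < E.card.descFactorial j := by
    rw [Nat.pos_iff_ne_zero, Ne, Nat.descFactorial_eq_zero_iff_lt]; omega
  refine Nat.le_of_mul_le_mul_left ?_ hpos
  have h1 : c * d.descFactorial j * E.card.descFactorial j ≤
      I.card.descFactorial j * (E.card.choose h * h.descFactorial j) := by
    simp only [Nat.descFactorial_eq_factorial_mul_choose]
    have := Nat.mul_le_mul_left (j.factorial * j.factorial) h0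
    calc _ = (j.factorial * j.factorial) * (c * d.choose j * E.card.choose j) := by ring
      _ ≤ _ := this
      _ = _ := by ring
  calc E.card.descFactorial j * (c * (E.card * (d + 1 - j)) ^ j)
      = (c * (d + 1 - j) ^ j * E.card.descFactorial j) * E.card ^ j := by rw [mul_pow]; ring
    _ ≤ (c * d.descFactorial j * E.card.descFactorial j) * E.card ^ j := by
        gcongr; exact Nat.pow_sub_le_descFactorial d j
    _ ≤ (I.card.descFactorial j * (E.card.choose h * h.descFactorial j)) * E.card ^ j := by
        gcongr
    _ = I.card.descFactorial j * E.card.choose h * (h.descFactorial j * E.card ^ j) := by ring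
    _ ≤ I.card ^ j * E.card.choose h * (E.card.descFactorial j * h ^ j) := by
        gcongr ?_ * _ * ?_
        · exact Nat.descFactorial_le_pow _ _
        · exact aux_desc _ _ hh j
    _ = _ := by rw [mul_pow]; ring

open Classical in
lemma aux_compl {n : ℕ} (G : SimpleGraph (Fin n)) :
    Gᶜ.edgeFinset.card + G.edgeSet.ncard = n.choose 2 := by
  have h1 : G.edgeSet.ncard = G.edgeFinset.card := by
    rw [Set.ncard_eq_toFinset_card']; rfl
  have h2 := card_edgeFinset_top_eq_card_choose_two (V := Fin n)
  rw [Fintype.card_fin] at h2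
  rw [h1, ← h2, ← Finset.card_union_of_disjoint]
  · congr 1
    rw [← edgeFinset_sup]
    congr!
    rw [sup_comm]; exact sup_compl_eq_top
  · rw [disjoint_edgeFinset]; exact disjoint_compl_left

open Classical in
lemma aux_tot {n m h : ℕ} (hm : m + h = n.choose 2) :
    Nat.card {G : SimpleGraph (Fin n) // G.edgeSet.ncard = m} = (n.choose 2).choose h := by
  have h2 := card_edgeFinset_top_eq_card_choose_two (V := Fin n)
  rw [Fintype.card_fin] at h2
  rw [← h2, ← Finset.card_powersetCard, Nat.card_eq_fintype_card, Fintype.card_subtype]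
  refine Finset.card_bij (fun G _ => Gᶜ.edgeFinset) ?_ ?_ ?_
  · intro G hG
    rw [Finset.mem_filter] at hG
    have := aux_compl G
    rw [Finset.mem_powersetCard]
    exact ⟨edgeFinset_mono le_top, by omega⟩
  · intro G _ G' _ he
    exact compl_injective (edgeFinset_inj.1 he)
  · intro T hT
    rw [Finset.mem_powersetCard] at hT
    obtain ⟨G, hG⟩ : ∃ G : SimpleGraph (Fin n), Gᶜ = fromEdgeSet (T : Set (Sym2 (Fin n))) :=
      ⟨(fromEdgeSet (T : Set (Sym2 (Fin n))))ᶜ, compl_compl _⟩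
    have hc : Gᶜ.edgeFinset = T := by
      ext e
      rw [mem_edgeFinset, hG, edgeSet_fromEdgeSet]
      have := @hT.1 e
      simp only [mem_edgeFinset, edgeSet_top] at this
      simp
      simpa using this
    refine ⟨G, ?_, hc⟩
    have := aux_compl G
    rw [hc] at this
    simp
    omega

open Classical in
lemma aux_bad {n m h d j : ℕ} (hm : m + h = n.choose 2) (hh : 1 ≤ h)
    (hd : 1 ≤ d) (hd' : d ≤ 2 ∨ 4 * (d - 1) ^ 2 < h) (hj : j ≤ n.choose 2) :
    Nat.card {G : SimpleGraph (Fin n) // G.edgeSet.ncard = m ∧ ¬ HasLegalSystem G} *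
      (n.choose 2 * (d + 1 - j)) ^ j ≤ n * ((n.choose 2).choose h * ((n - 1) * h) ^ j) := by
  have h2 := card_edgeFinset_top_eq_card_choose_two (V := Fin n)
  rw [Fintype.card_fin] at h2
  set E := (⊤ : SimpleGraph (Fin n)).edgeFinset with hE
  let B : Fin n → Finset (Finset (Sym2 (Fin n))) := fun v =>
    (E.powersetCard h).filter fun T => d ≤ (T ∩ (⊤ : SimpleGraph (Fin n)).incidenceFinset v).card
  have hB : ∀ v, (B v).card * (n.choose 2 * (d + 1 - j)) ^ j ≤
      (n.choose 2).choose h * ((n - 1) * h) ^ j := by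
    intro v
    have := aux_count2 E ((⊤ : SimpleGraph (Fin n)).incidenceFinset v)
      (incidenceFinset_subset _ _) h d j (by omega) (by omega)
    rw [h2, card_incidenceFinset_eq_degree, complete_graph_degree, Fintype.card_fin] at this
    convert this
  have hle : Nat.card {G : SimpleGraph (Fin n) // G.edgeSet.ncard = m ∧ ¬ HasLegalSystem G} ≤
      ∑ v, (B v).card := by
    rw [Nat.card_eq_fintype_card, Fintype.card_subtype]
    refine le_trans ?_ (Finset.card_biUnion_le (s := Finset.univ) (t := B))
    refine Finset.card_le_card_of_injOn (fun G => Gᶜ.edgeFinset) ?_ ?_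
    · intro G hG
      simp only [Finset.coe_filter, Finset.mem_univ, true_and, Set.mem_ofPred_eq] at hG
      have hc := aux_compl G
      have hex : ∃ v, d ≤ Gᶜ.degree v := by
        by_contra! hcon
        refine hG.2 (aux_det G (d - 1) (fun v => by have := hcon v; omega) (by omega) ?_)
        rcases hd' with h | h
        · left; omega
        · right; refine h.trans_le ?_; omega
      obtain ⟨v, hv⟩ := hex
      simp only [Finset.coe_biUnion, Set.mem_iUnion]
      refine ⟨v, by simp, ?_⟩
      simp only [B, Finset.coe_filter, Set.mem_ofPred_eq, Finset.mem_powersetCard]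
      refine ⟨⟨edgeFinset_mono le_top, by omega⟩, ?_⟩
      refine hv.trans ?_
      rw [← card_incidenceFinset_eq_degree]
      refine Finset.card_le_card ?_
      intro e he
      rw [mem_incidenceFinset] at he
      rw [Finset.mem_inter, mem_incidenceFinset, mem_edgeFinset]
      exact ⟨he.1, edgeSet_mono le_top he.1, he.2⟩
    · intro G _ G' _ he
      exact compl_injective (edgeFinset_inj.1 he)
  calc _ ≤ (∑ v, (B v).card) * (n.choose 2 * (d + 1 - j)) ^ j := Nat.mul_le_mul_right _ hle
    _ = ∑ v, (B v).card * (n.choose 2 * (d + 1 - j)) ^ j := by rw [Finset.sum_mul]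
    _ ≤ ∑ v : Fin n, (n.choose 2).choose h * ((n - 1) * h) ^ j :=
        Finset.sum_le_sum fun v _ => hB v
    _ = _ := by simp

lemma aux_bad2 {n m h d j : ℕ} (hn : 2 ≤ n) (hm : m + h = n.choose 2) (hh : 1 ≤ h)
    (hd : 1 ≤ d) (hd' : d ≤ 2 ∨ 4 * (d - 1) ^ 2 < h) (hj : j ≤ n.choose 2) :
    Nat.card {G : SimpleGraph (Fin n) // G.edgeSet.ncard = m ∧ ¬ HasLegalSystem G} *
      (n * (d + 1 - j)) ^ j ≤ n * ((n.choose 2).choose h * (2 * h) ^ j) := by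
  have h0 := aux_bad hm hh hd hd' hj
  have hN : 2 * n.choose 2 = n * (n - 1) := by
    rw [Nat.choose_two_right]
    exact Nat.mul_div_cancel' (Nat.even_mul_pred_self n).two_dvd
  have hpos : 0 < (n - 1) ^ j := Nat.pow_pos (by omega)
  refine Nat.le_of_mul_le_mul_left ?_ hpos
  set c := Nat.card {G : SimpleGraph (Fin n) // G.edgeSet.ncard = m ∧ ¬ HasLegalSystem G}
  calc (n - 1) ^ j * (c * (n * (d + 1 - j)) ^ j)
      = c * ((n * (n - 1)) * (d + 1 - j)) ^ j := by simp only [mul_pow]; ring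
    _ = 2 ^ j * (c * (n.choose 2 * (d + 1 - j)) ^ j) := by
        rw [← hN]; simp only [mul_pow]; ring
    _ ≤ 2 ^ j * (n * ((n.choose 2).choose h * ((n - 1) * h) ^ j)) := Nat.mul_le_mul_left _ h0
    _ = _ := by simp only [mul_pow]; ring

lemma aux_eps (ε : ℝ) (hε : 0 < ε) : ∃ n0 : ℕ, ∀ n ≥ n0, ∀ m h : ℕ, m + h = n.choose 2 →
    1 ≤ h → 100 * h ≤ n ^ 2 →
    (Nat.card {G : SimpleGraph (Fin n) // G.edgeSet.ncard = m ∧ ¬ HasLegalSystem G} : ℝ) ≤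
      ε * ((n.choose 2).choose h : ℕ) := by
  have ht := tendsto_pow_const_div_const_pow_of_one_lt 6 (r := (2 : ℝ)) one_lt_two
  have hC : (0 : ℝ) < ε / (64 * 9 ^ 6) := by positivity
  obtain ⟨J0, hJ0⟩ := eventually_atTop.1 (ht.eventually_le_const hC)
  obtain ⟨n1, hn1⟩ := exists_nat_gt (64 / ε ^ 3)
  refine ⟨n1 + 64 * (5 * (J0 + 1) + 5) ^ 6 + 3, ?_⟩
  intro n hn m h hm hh hhn
  have hn3 : 3 ≤ n := by omega
  have hnJ : 64 * (5 * (J0 + 1) + 5) ^ 6 < n := by omega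
  have hnn1 : (n1 : ℝ) ≤ n := by exact_mod_cast (by omega : n1 ≤ n)
  have hnpos : (0 : ℝ) < n := by exact_mod_cast (by omega : 0 < n)
  set c := Nat.card {G : SimpleGraph (Fin n) // G.edgeSet.ncard = m ∧ ¬ HasLegalSystem G} with hc
  set tot := (n.choose 2).choose h with htot
  by_cases hA : h ^ 3 ≤ n
  · have hN : 2 ≤ n.choose 2 :=
      le_trans (by decide : 2 ≤ Nat.choose 3 2) (Nat.choose_le_choose 2 hn3)
    have h0 := aux_bad2 (d := 2) (j := 2) (by omega) hm hh (by norm_num) (Or.inl le_rfl) hN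
    rw [← hc, ← htot] at h0
    have h1 : c * n ≤ tot * (4 * h ^ 2) := by
      refine Nat.le_of_mul_le_mul_left ?_ (by omega : 0 < n)
      calc n * (c * n) = c * (n * (2 + 1 - 2)) ^ 2 := by norm_num; ring
        _ ≤ _ := h0
        _ = _ := by ring
    have h1' : (c : ℝ) * n ≤ tot * (4 * h ^ 2) := by exact_mod_cast h1
    have hA' : (h : ℝ) ^ 3 ≤ n := by exact_mod_cast hA
    have h2 : (4 * (h : ℝ) ^ 2) ≤ ε * n := by
      refine le_of_pow_le_pow_left₀ (n := 3) (by norm_num) (by positivity) ?_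
      have h64 : 64 ≤ ε ^ 3 * n := by
        have : 64 / ε ^ 3 ≤ n := hn1.le.trans hnn1
        rw [div_le_iff₀ (by positivity)] at this
        linarith
      calc (4 * (h : ℝ) ^ 2) ^ 3 = 64 * (h ^ 3) ^ 2 := by ring
        _ ≤ 64 * (n : ℝ) ^ 2 := by gcongr
        _ ≤ (ε ^ 3 * n) * (n : ℝ) ^ 2 := by gcongr
        _ = _ := by ring
    refine le_of_mul_le_mul_right ?_ hnpos
    calc (c : ℝ) * n ≤ tot * (4 * h ^ 2) := h1'
      _ ≤ tot * (ε * n) := by gcongr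
      _ = _ := by ring
  · push Not at hA
    have hex : ∃ d, h ≤ 4 * d ^ 2 := ⟨h, by nlinarith⟩
    classical
    obtain ⟨d, hd, hdmin⟩ : ∃ d, h ≤ 4 * d ^ 2 ∧ ∀ d' < d, ¬ h ≤ 4 * d' ^ 2 :=
      ⟨Nat.find hex, Nat.find_spec hex, fun d' => Nat.find_min hex⟩
    have hd1 : 1 ≤ d := by
      by_contra hcon
      have : d = 0 := by omega
      subst this
      omega
    have hd2 : 4 * (d - 1) ^ 2 < h := not_le.1 (hdmin (d - 1) (by omega))
    have hdh : d ≤ h := by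
      have : d - 1 ≤ 4 * (d - 1) ^ 2 := by nlinarith
      omega
    have h0 := aux_bad2 (d := d) (j := d / 5) (by omega) hm hh hd1 (Or.inr hd2) (by omega)
    rw [← hc, ← htot] at h0
    have hnd : 5 * h ≤ n * d := by
      refine le_of_pow_le_pow_left₀ (n := 2) (by norm_num) (by positivity) ?_
      have := Nat.mul_le_mul hhn hd
      nlinarith
    set j := d / 5 with hj
    have hb : 4 * h ≤ n * (d + 1 - j) := by
      have h5 : 4 * d ≤ 5 * (d + 1 - j) := by omega
      have := Nat.mul_le_mul_left n h5
      nlinarith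
    have h1 : c * 2 ^ j ≤ n * tot := by
      refine Nat.le_of_mul_le_mul_left ?_ (Nat.pow_pos (by omega) : 0 < (2 * h) ^ j)
      calc (2 * h) ^ j * (c * 2 ^ j) = c * (4 * h) ^ j := by
            rw [show 4 * h = (2 * h) * 2 by ring, mul_pow (2 * h)]; ring
        _ ≤ c * (n * (d + 1 - j)) ^ j := by gcongr
        _ ≤ _ := h0
        _ = _ := by ring
    have hn6 : n < 64 * d ^ 6 := by
      calc n < h ^ 3 := hA
        _ ≤ (4 * d ^ 2) ^ 3 := by gcongr
        _ = _ := by ring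
    have hjJ : J0 + 1 ≤ j := by
      by_contra! hcon
      have : d ≤ 5 * (J0 + 1) + 5 := by omega
      have : 64 * d ^ 6 ≤ 64 * (5 * (J0 + 1) + 5) ^ 6 := by gcongr
      omega
    have hnj : n ≤ 64 * 9 ^ 6 * j ^ 6 := by
      have : d ≤ 9 * j := by omega
      calc n ≤ 64 * d ^ 6 := hn6.le
        _ ≤ 64 * (9 * j) ^ 6 := by gcongr
        _ = _ := by ring
    have h2 := hJ0 j (by omega)
    rw [div_le_iff₀ (by positivity), div_mul_eq_mul_div, le_div_iff₀ (by positivity)] at h2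
    have hnj' : (n : ℝ) ≤ 64 * 9 ^ 6 * j ^ 6 := by exact_mod_cast hnj
    have h1' : (c : ℝ) * 2 ^ j ≤ n * tot := by exact_mod_cast h1
    refine le_of_mul_le_mul_right ?_ (by positivity : (0 : ℝ) < 2 ^ j)
    calc (c : ℝ) * 2 ^ j ≤ n * tot := h1'
      _ ≤ (ε * 2 ^ j) * tot := by gcongr; linarith
      _ = _ := by ring

theorem aas_dense_gnm_has_legal_system (m : ℕ → ℕ)
    (hm : ∀ᶠ n : ℕ in atTop,
      (0.98 : ℝ) * (n.choose 2) ≤ (m n : ℝ) ∧ m n < n.choose 2) :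
    Tendsto (fun n : ℕ =>
        ((Nat.card {G : SimpleGraph (Fin n) //
            G.edgeSet.ncard = m n ∧ HasLegalSystem G} : ℝ) /
          (Nat.card {G : SimpleGraph (Fin n) // G.edgeSet.ncard = m n} : ℝ)))
      atTop (nhds 1) := by
  rw [Metric.tendsto_atTop']
  intro ε hε
  obtain ⟨n0, hn0⟩ := aux_eps (ε / 2) (by positivity)
  obtain ⟨n1, hn1⟩ := eventually_atTop.1 hm
  refine ⟨n0 + n1, ?_⟩
  intro n hn
  obtain ⟨hm1, hm2⟩ := hn1 n (by omega)
  obtain ⟨h, hh⟩ : ∃ h, m n + h = n.choose 2 := ⟨n.choose 2 - m n, by omega⟩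
  have hN : 2 * n.choose 2 = n * (n - 1) := by
    rw [Nat.choose_two_right]
    exact Nat.mul_div_cancel' (Nat.even_mul_pred_self n).two_dvd
  have hsq : 100 * h ≤ n ^ 2 := by
    have h1 : n * (n - 1) ≤ n ^ 2 := by
      rw [pow_two]; exact Nat.mul_le_mul_left _ (by omega)
    have h2 : 2 * n.choose 2 ≤ n ^ 2 := by omega
    have h2' : 2 * (n.choose 2 : ℝ) ≤ (n : ℝ) ^ 2 := by exact_mod_cast h2
    have h3 : (m n : ℝ) + h = n.choose 2 := by exact_mod_cast hh
    have : 100 * (h : ℝ) ≤ (n : ℝ) ^ 2 := by linarith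
    exact_mod_cast this
  have hbad := hn0 n (by omega) (m n) h hh (by omega) hsq
  have htot := aux_tot hh
  have hpos : 0 < (n.choose 2).choose h := Nat.choose_pos (by omega)
  have hsum : Nat.card {G : SimpleGraph (Fin n) // G.edgeSet.ncard = m n ∧ HasLegalSystem G} +
      Nat.card {G : SimpleGraph (Fin n) // G.edgeSet.ncard = m n ∧ ¬ HasLegalSystem G} =
      Nat.card {G : SimpleGraph (Fin n) // G.edgeSet.ncard = m n} := by
    classical
    simp only [Nat.card_eq_fintype_card, Fintype.card_subtype]
    rw [← Finset.filter_filter, ← Finset.filter_filter]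
    exact Finset.card_filter_add_card_filter_not _
  rw [htot] at hsum ⊢
  have hsum' : (Nat.card {G : SimpleGraph (Fin n) // G.edgeSet.ncard = m n ∧ HasLegalSystem G} : ℝ) +
      Nat.card {G : SimpleGraph (Fin n) // G.edgeSet.ncard = m n ∧ ¬ HasLegalSystem G} =
      ((n.choose 2).choose h : ℕ) := by exact_mod_cast hsum
  have hpos' : (0 : ℝ) < ((n.choose 2).choose h : ℕ) := by exact_mod_cast hpos
  have hbn : (0 : ℝ) ≤ Nat.card {G : SimpleGraph (Fin n) // G.edgeSet.ncard = m n ∧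
    ¬ HasLegalSystem G} := Nat.cast_nonneg _
  rw [Real.dist_eq, div_sub_one hpos'.ne', abs_div, abs_of_pos hpos', div_lt_iff₀ hpos', abs_lt]
  constructor <;> nlinarith
end

section
/- Let (p_n) be a sequence with 3 log n / n ≤ p_n ≤ 0.99 for all large n, and let G ∼ 𝒢(n, p_n). Then asymptotically almost surely G has a legal system. -/
open SimpleGraph

open MeasureTheory Filter

/-- Bernoulli measure on `Bool` with success probability `p`. -/
noncomputable def bernoulliMeasure (p : ℝ) : Measure Bool :=
  ENNReal.ofReal p • Measure.dirac true + ENNReal.ofReal (1 - p) • Measure.dirac false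

/-- The Erdős–Rényi measure `𝒢(n,p)`: the product over all (unordered) vertex pairs of
Bernoulli(p) indicators. -/
noncomputable def erdosRenyi (n : ℕ) (p : ℝ) : Measure (Sym2 (Fin n) → Bool) :=
  Measure.pi fun _ => bernoulliMeasure p

/-- The simple graph on `{1,…,n}` determined by an indicator `ω` of the edges. -/
def graphOf {n : ℕ} (ω : Sym2 (Fin n) → Bool) : SimpleGraph (Fin n) where
  Adj u v := u ≠ v ∧ ω s(u, v) = true
  symm := by
    constructor
    intro u v h
    exact ⟨h.1.symm, by rw [Sym2.eq_swap]; exact h.2⟩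
  loopless := ⟨fun v h => h.1 rfl⟩

instance {n : ℕ} (ω : Sym2 (Fin n) → Bool) : DecidableRel (graphOf ω).Adj :=
  fun u v => inferInstanceAs (Decidable (u ≠ v ∧ ω s(u, v) = true))

lemma integral_bern (p : ℝ) (hp0 : 0 ≤ p) (hp1 : p ≤ 1) (f : Bool → ℝ) :
    ∫ b, f b ∂(bernoulliMeasure p) = p * f true + (1 - p) * f false := by
  unfold bernoulliMeasure
  have h (b : Bool) (c : ℝ) : Integrable f (ENNReal.ofReal c • Measure.dirac b) :=
    (Integrable.of_finite (μ := Measure.dirac b)).smul_measure ENNReal.ofReal_ne_top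
  rw [integral_add_measure (h _ _) (h _ _),
    integral_smul_measure, integral_smul_measure, integral_dirac, integral_dirac,
    ENNReal.toReal_ofReal hp0, ENNReal.toReal_ofReal (by linarith)]
  simp

lemma bern_prob (p : ℝ) (hp0 : 0 ≤ p) (hp1 : p ≤ 1) :
    IsProbabilityMeasure (bernoulliMeasure p) := by
  constructor
  simp only [bernoulliMeasure, Measure.coe_add, Measure.coe_smul, Pi.add_apply, Pi.smul_apply,
    measure_univ, smul_eq_mul, mul_one]
  rw [← ENNReal.ofReal_add hp0 (by linarith)]
  simp

lemma er_prob (n : ℕ) (p : ℝ) (hp0 : 0 ≤ p) (hp1 : p ≤ 1) :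
    IsProbabilityMeasure (erdosRenyi n p) := by
  have := bern_prob p hp0 hp1
  unfold erdosRenyi
  infer_instance

lemma E_prod (n : ℕ) (p : ℝ) (hp0 : 0 ≤ p) (hp1 : p ≤ 1) (f : Bool → ℝ)
    (T : Finset (Sym2 (Fin n))) :
    ∫ ω, ∏ e ∈ T, f (ω e) ∂(erdosRenyi n p) = (p * f true + (1 - p) * f false) ^ T.card := by
  have := bern_prob p hp0 hp1
  unfold erdosRenyi
  have h1 : ∀ ω : Sym2 (Fin n) → Bool, ∏ e ∈ T, f (ω e)
      = ∏ e, (fun e b => if e ∈ T then f b else 1) e (ω e) := by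
    intro ω
    simp [Finset.prod_ite_mem]
  simp_rw [h1]
  rw [integral_fintype_prod_eq_prod (fun (e : Sym2 (Fin n)) b => if e ∈ T then f b else 1)]
  have h2 : ∀ e, ∫ b, (if e ∈ T then f b else 1) ∂(bernoulliMeasure p)
      = if e ∈ T then (p * f true + (1 - p) * f false) else 1 := by
    intro e
    rw [integral_bern p hp0 hp1]
    split_ifs <;> ring
  simp_rw [h2]
  simp [Finset.prod_ite_mem]

lemma real_le_E (n : ℕ) (p : ℝ) (hp0 : 0 ≤ p) (hp1 : p ≤ 1) (A : Set (Sym2 (Fin n) → Bool))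
    (f : (Sym2 (Fin n) → Bool) → ℝ) (h0 : ∀ ω, 0 ≤ f ω) (h1 : ∀ ω ∈ A, 1 ≤ f ω) :
    (erdosRenyi n p).real A ≤ ∫ ω, f ω ∂(erdosRenyi n p) := by
  have := er_prob n p hp0 hp1
  have hA : MeasurableSet A := A.toFinite.measurableSet
  rw [← integral_indicator_one hA]
  apply integral_mono (Integrable.of_finite) (Integrable.of_finite)
  intro ω
  by_cases h : ω ∈ A
  · simpa [h] using h1 ω h
  · simpa [h] using h0 ω

/-- All pairs in `T` are non-edges. -/
lemma prob_none (n : ℕ) (p : ℝ) (hp0 : 0 ≤ p) (hp1 : p ≤ 1) (T : Finset (Sym2 (Fin n))) :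
    (erdosRenyi n p).real {ω | ∀ e ∈ T, ω e = false} ≤ (1 - p) ^ T.card := by
  have := E_prod n p hp0 hp1 (fun b => if b then 0 else 1) T
  simp only [if_true, mul_zero, zero_add] at this
  simp only [Bool.false_eq_true, if_false, mul_one] at this
  rw [← this]
  apply real_le_E n p hp0 hp1
  · intro ω
    apply Finset.prod_nonneg
    intro e _
    split_ifs <;> norm_num
  · intro ω hω
    rw [Finset.prod_eq_one]
    intro e he
    simp [hω e he]

lemma prob_hit (n : ℕ) (p : ℝ) (hp0 : 0 ≤ p) (hp1 : p ≤ 1) {ι : Type*} [DecidableEq ι]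
    (I : Finset ι) (T : ι → Finset (Sym2 (Fin n)))
    (hT : Set.PairwiseDisjoint (I : Set ι) T) :
    (erdosRenyi n p).real {ω | ∀ i ∈ I, ∃ e ∈ T i, ω e = true}
      ≤ ∏ i ∈ I, (1 - (1 - p) ^ (T i).card) := by
  have := er_prob n p hp0 hp1
  let g : Bool → ℝ := fun b => if b then 0 else 1
  have hg : ∀ b, 0 ≤ g b ∧ g b ≤ 1 := by intro b; cases b <;> simp [g]
  have key : ∫ ω, ∏ i ∈ I, (1 - ∏ e ∈ T i, g (ω e)) ∂(erdosRenyi n p)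
      = ∏ i ∈ I, (1 - (1 - p) ^ (T i).card) := by
    simp_rw [sub_eq_add_neg, Finset.prod_one_add]
    rw [integral_finsetSum _ (fun _ _ => Integrable.of_finite)]
    apply Finset.sum_congr rfl
    intro J hJ
    have hJ' := Finset.mem_powerset.1 hJ
    have hd : Set.PairwiseDisjoint (J : Set ι) T := hT.subset (by exact_mod_cast hJ')
    have h1 : ∀ ω : Sym2 (Fin n) → Bool, ∏ i ∈ J, (-∏ e ∈ T i, g (ω e))
        = (-1) ^ J.card * ∏ e ∈ J.biUnion T, g (ω e) := by
      intro ω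
      rw [Finset.prod_biUnion hd, Finset.prod_neg]
    simp_rw [h1]
    rw [integral_const_mul, E_prod n p hp0 hp1, Finset.prod_neg, Finset.card_biUnion hd,
      Finset.prod_pow_eq_pow_sum]
    simp [g, sub_eq_add_neg]
  rw [← key]
  have hle : ∀ (ω : Sym2 (Fin n) → Bool) i, ∏ e ∈ T i, g (ω e) ≤ 1 := fun ω i =>
    Finset.prod_le_one (fun e _ => (hg _).1) (fun e _ => (hg _).2)
  apply real_le_E n p hp0 hp1
  · intro ω
    apply Finset.prod_nonneg
    intro i _
    linarith [hle ω i]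
  · intro ω hω
    rw [Finset.prod_eq_one]
    intro i hi
    obtain ⟨e, he, h⟩ := hω i hi
    rw [Finset.prod_eq_zero he (by simp [g, h])]
    simp

lemma prob_many (n : ℕ) (p : ℝ) (hp0 : 0 ≤ p) (hp1 : p ≤ 1) (T : Finset (Sym2 (Fin n)))
    (l : ℝ) (hl : 0 ≤ l) (m : ℝ) :
    (erdosRenyi n p).real {ω | m ≤ (((T.filter (fun e => ω e = true)).card : ℕ) : ℝ)}
      ≤ Real.exp (Real.exp l * p * T.card - l * m) := by
  let g : Bool → ℝ := fun b => if b then Real.exp l else 1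
  have h := E_prod n p hp0 hp1 g T
  have hb : (p * g true + (1 - p) * g false) ^ T.card ≤ Real.exp (Real.exp l * p * T.card) := by
    rw [mul_comm _ (T.card : ℝ), Real.exp_nat_mul]
    apply pow_le_pow_left₀
    · simp only [g, if_true]
      have := Real.exp_pos l
      have : 0 ≤ p * Real.exp l := by positivity
      simp; linarith
    · have := Real.add_one_le_exp (Real.exp l * p)
      simp [g]; nlinarith
  have : (erdosRenyi n p).real {ω | m ≤ (((T.filter (fun e => ω e = true)).card : ℕ) : ℝ)}
      ≤ ∫ ω, Real.exp (- l * m) * ∏ e ∈ T, g (ω e) ∂(erdosRenyi n p) := by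
    have hx : ∀ ω : Sym2 (Fin n) → Bool, ∏ e ∈ T, g (ω e)
        = Real.exp (l * (T.filter (fun e => ω e = true)).card) := by
      intro ω
      simp only [g]
      rw [Finset.prod_ite]
      simp [← Real.exp_nat_mul, mul_comm]
    apply real_le_E n p hp0 hp1
    · intro ω
      rw [hx]; positivity
    · intro ω hω
      rw [hx, ← Real.exp_add]
      apply Real.one_le_exp
      have := mul_le_mul_of_nonneg_left (show m ≤ _ from hω) hl
      linarith
  refine this.trans ?_
  rw [integral_const_mul, h, show Real.exp l * p * T.card - l * m
    = -l * m + Real.exp l * p * T.card by ring, Real.exp_add]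
  exact mul_le_mul_of_nonneg_left hb (Real.exp_pos _).le

lemma det_legal {V α : Type*} [Fintype V] [Fintype α] (G : SimpleGraph V) (C : V → α)
    (hC : ∀ u v, G.Adj u v → C u ≠ C v)
    (hcount : Nat.card {S : Set V // ¬ LegalState G S} * 2 ^ Fintype.card α
      < 2 ^ Fintype.card V) : HasLegalSystem G := by
  classical
  by_contra hno
  have h1 : ∀ S : Set V, ∃ ε : α → ZMod 2, ¬ LegalState G (actSet (fun v => ε (C v)) S) := by
    intro S
    by_contra hS
    push Not at hS
    apply hno
    refine ⟨S, fun v => {u | C u = C v}, fun v => ⟨rfl, fun u hu h => hC _ _ h hu.symm⟩, ?_⟩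
    intro g hg
    let K : AddSubgroup (V → ZMod 2) :=
      { carrier := {g | ∃ ε : α → ZMod 2, g = fun v => ε (C v)}
        add_mem' := by
          rintro _ _ ⟨a, rfl⟩ ⟨b, rfl⟩
          exact ⟨a + b, rfl⟩
        zero_mem' := ⟨0, rfl⟩
        neg_mem' := by
          rintro _ ⟨a, rfl⟩
          exact ⟨-a, rfl⟩ }
    have hK : g ∈ K := by
      refine (AddSubgroup.closure_le K).2 ?_ hg
      rintro _ ⟨v, rfl⟩
      refine ⟨fun a => if a = C v then 1 else 0, ?_⟩
      funext u
      simp [chi, Set.indicator_apply]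
    obtain ⟨ε, rfl⟩ := hK
    exact hS ε
  choose ε hε using h1
  have hinj : Function.Injective (fun S : Set V =>
      ((⟨actSet (fun v => ε S (C v)) S, hε S⟩ : {S : Set V // ¬ LegalState G S}), ε S)) := by
    intro S T h
    simp only [Prod.mk.injEq, Subtype.mk.injEq] at h
    obtain ⟨h1, h2⟩ := h
    rw [h2] at h1
    ext x
    have hx : x ∈ actSet (fun v => ε T (C v)) S ↔ x ∈ actSet (fun v => ε T (C v)) T := by
      rw [h1]
    simp only [actSet, Set.mem_ofPred_eq, chi, Set.indicator_apply, Pi.one_apply] at hx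
    generalize ε T (C x) = a at hx
    have ha : a = 0 ∨ a = 1 := by
      clear hx; revert a; decide
    by_cases hS : x ∈ S <;> by_cases hT : x ∈ T <;> rcases ha with rfl | rfl <;>
      simp [hS, hT] at hx ⊢
  have := Nat.card_le_card_of_injective _ hinj
  rw [Nat.card_prod, Nat.card_eq_fintype_card, Fintype.card_set] at this
  have h3 : Nat.card (α → ZMod 2) = 2 ^ Fintype.card α := by
    rw [Nat.card_eq_fintype_card, Fintype.card_fun, ZMod.card]
  rw [h3] at this
  omega

lemma disconn_split {V : Type*} [Fintype V] [DecidableEq V] (G : SimpleGraph V) (T : Set V)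
    (hT : ¬ (G.induce T).Connected) :
    T = ∅ ∨ ∃ A B : Finset V, Disjoint A B ∧ A.Nonempty ∧ A.card ≤ B.card ∧
      (∀ a ∈ A, ∀ b ∈ B, ¬ G.Adj a b) ∧ T = ((A ∪ B : Finset V) : Set V) := by
  classical
  by_cases hne : T = ∅
  · exact Or.inl hne
  right
  have hne' : Nonempty T := (Set.nonempty_iff_ne_empty.2 hne).to_subtype
  have hpre : ¬ (G.induce T).Preconnected := fun h => hT ⟨h⟩
  unfold SimpleGraph.Preconnected at hpre
  push Not at hpre
  obtain ⟨x, y, hxy⟩ := hpre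
  let A : Finset V := Finset.univ.filter (fun v => ∃ h : v ∈ T, (G.induce T).Reachable x ⟨v, h⟩)
  let B : Finset V :=
    Finset.univ.filter (fun v => ∃ h : v ∈ T, ¬ (G.induce T).Reachable x ⟨v, h⟩)
  have hAB : Disjoint A B := by
    rw [Finset.disjoint_left]
    intro v hv hv'
    simp only [A, B, Finset.mem_filter, Finset.mem_univ, true_and] at hv hv'
    obtain ⟨h, h1⟩ := hv
    obtain ⟨_, h2⟩ := hv'
    exact h2 h1
  have hA : A.Nonempty := ⟨x, by simp [A]⟩
  have hB : B.Nonempty := ⟨y, by simpa [B] using hxy⟩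
  have hno : ∀ a ∈ A, ∀ b ∈ B, ¬ G.Adj a b := by
    intro a ha b hb hadj
    simp only [A, B, Finset.mem_filter, Finset.mem_univ, true_and] at ha hb
    obtain ⟨h, h1⟩ := ha
    obtain ⟨h', h2⟩ := hb
    apply h2
    refine h1.trans (SimpleGraph.Adj.reachable ?_)
    simpa using hadj
  have hU : T = ((A ∪ B : Finset V) : Set V) := by
    ext v
    simp only [A, B, Finset.coe_union, Finset.coe_filter, Finset.mem_univ, true_and,
      Set.mem_union, Set.mem_ofPred_eq]
    constructor
    · intro h
      by_cases hr : (G.induce T).Reachable x ⟨v, h⟩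
      · exact Or.inl ⟨h, hr⟩
      · exact Or.inr ⟨h, hr⟩
    · rintro (⟨h, _⟩ | ⟨h, _⟩) <;> exact h
  rcases le_total A.card B.card with h | h
  · exact ⟨A, B, hAB, hA, h, hno, hU⟩
  · exact ⟨B, A, hAB.symm, hB, h, fun b hb a ha hh => hno a ha b hb hh.symm,
      by rw [hU, Finset.union_comm]⟩

/-- The candidate pairs. -/
def pairsOf (n : ℕ) : Finset (Finset (Fin n) × Finset (Fin n)) :=
  Finset.univ.filter (fun x => Disjoint x.1 x.2 ∧ x.1.Nonempty ∧ x.1.card ≤ x.2.card)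

open Classical in
lemma illegal_count (n : ℕ) (G : SimpleGraph (Fin n)) :
    Nat.card {S : Set (Fin n) // ¬ LegalState G S} ≤
      2 * (1 + ((pairsOf n).filter (fun x => ∀ a ∈ x.1, ∀ b ∈ x.2, ¬ G.Adj a b)).card) := by
  set P := (pairsOf n).filter (fun x => ∀ a ∈ x.1, ∀ b ∈ x.2, ¬ G.Adj a b) with hP
  let D : Finset (Set (Fin n)) := insert ∅ (P.image (fun x => ((x.1 ∪ x.2 : Finset (Fin n)) :
    Set (Fin n))))
  have hD : D.card ≤ 1 + P.card := by
    refine (Finset.card_insert_le _ _).trans ?_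
    have : (P.image (fun x => ((x.1 ∪ x.2 : Finset (Fin n)) : Set (Fin n)))).card ≤ P.card :=
      Finset.card_image_le
    omega
  have hmem : ∀ T : Set (Fin n), ¬ (G.induce T).Connected → T ∈ D := by
    intro T hT
    rcases disconn_split G T hT with h | ⟨A, B, h1, h2, h3, h4, h5⟩
    · simp [D, h]
    · refine Finset.mem_insert_of_mem (Finset.mem_image.2 ⟨(A, B), ?_, h5.symm⟩)
      simp only [hP, pairsOf, Finset.mem_filter, Finset.mem_univ, true_and]
      exact ⟨⟨h1, h2, h3⟩, h4⟩
  have hsub : (Finset.univ.filter (fun S : Set (Fin n) => ¬ LegalState G S)) ⊆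
      D ∪ D.image (fun S => Sᶜ) := by
    intro S hS
    simp only [Finset.mem_filter, Finset.mem_univ, true_and] at hS
    rw [Finset.mem_union]
    by_cases h1 : (G.induce S).Connected
    · right
      rw [Finset.mem_image]
      refine ⟨Sᶜ, hmem _ ?_, compl_compl S⟩
      intro h2
      apply hS
      refine ⟨?_, ?_, h1, h2⟩
      · obtain ⟨x⟩ := h1.nonempty
        exact ⟨x.1, x.2⟩
      · obtain ⟨x⟩ := h2.nonempty
        exact ⟨x.1, x.2⟩
    · exact Or.inl (hmem _ h1)
  have h1 := Finset.card_le_card hsub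
  have h2 := Finset.card_union_le D (D.image (fun S => Sᶜ))
  have h3 : (D.image (fun S => Sᶜ)).card ≤ D.card := Finset.card_image_le
  rw [Nat.card_eq_fintype_card, Fintype.card_subtype]
  omega

open Classical in
lemma degen_color {V : Type*} [Fintype V] (G : SimpleGraph V) (k s : ℕ)
    (h : ∀ U : Finset V, U.Nonempty → U.card ≤ s →
      ∃ v ∈ U, (U.filter (fun u => G.Adj v u)).card < k) (hk : 0 < k) :
    ∀ U : Finset V, U.card ≤ s → ∃ c : V → Fin k, ∀ u ∈ U, ∀ v ∈ U, G.Adj u v → c u ≠ c v := by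
  intro U
  induction U using Finset.strongInduction with
  | H U ih =>
    intro hs
    rcases U.eq_empty_or_nonempty with rfl | hne
    · exact ⟨fun _ => ⟨0, hk⟩, by simp⟩
    obtain ⟨v, hv, hdeg⟩ := h U hne hs
    obtain ⟨c, hc⟩ := ih (U.erase v) (Finset.erase_ssubset hv)
      ((Finset.card_le_card (Finset.erase_subset _ _)).trans hs)
    obtain ⟨j, hj⟩ : ∃ j : Fin k, j ∉ (U.filter (fun u => G.Adj v u)).image c := by
      by_contra hcon
      push Not at hcon
      have h1 : (Finset.univ : Finset (Fin k)) ⊆ (U.filter (fun u => G.Adj v u)).image c :=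
        fun j _ => hcon j
      have h2 := Finset.card_le_card h1
      have h3 : ((U.filter (fun u => G.Adj v u)).image c).card ≤ _ := Finset.card_image_le
      simp at h2
      omega
    have hj' : ∀ u ∈ U, G.Adj v u → c u ≠ j := by
      intro u hu hvu hcu
      exact hj (Finset.mem_image.2 ⟨u, Finset.mem_filter.2 ⟨hu, hvu⟩, hcu⟩)
    refine ⟨Function.update c v j, ?_⟩
    intro a ha b hb hab
    by_cases h1 : a = v
    · subst h1
      rw [Function.update_self, Function.update_of_ne hab.ne']
      exact (hj' b hb hab).symm
    · by_cases h2 : b = v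
      · subst h2
        rw [Function.update_self, Function.update_of_ne h1]
        exact hj' a ha hab.symm
      · rw [Function.update_of_ne h1, Function.update_of_ne h2]
        exact hc a (Finset.mem_erase.2 ⟨h1, ha⟩) b (Finset.mem_erase.2 ⟨h2, hb⟩) hab

open Classical in
lemma max_partial {V : Type*} [Fintype V] (G : SimpleGraph V) (k : ℕ) :
    ∃ f : V → Option (Fin k),
      (∀ u v, G.Adj u v → f u ≠ none → f u ≠ f v) ∧
      (∀ v, f v = none → ∀ j : Fin k, ∃ u, f u = some j ∧ G.Adj u v) := by
  let P : Finset (V → Option (Fin k)) :=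
    Finset.univ.filter (fun f => ∀ u v, G.Adj u v → f u ≠ none → f u ≠ f v)
  have hP : P.Nonempty := ⟨fun _ => none, by simp [P]⟩
  obtain ⟨f, hf, hmin⟩ := Finset.exists_min_image P
    (fun f => (Finset.univ.filter (fun v => f v = none)).card) hP
  have hf' : ∀ u v, G.Adj u v → f u ≠ none → f u ≠ f v := by simpa [P] using hf
  refine ⟨f, hf', ?_⟩
  intro v hv j
  by_contra hcon
  push Not at hcon
  have hg : Function.update f v (some j) ∈ P := by
    simp only [P, Finset.mem_filter, Finset.mem_univ, true_and]
    intro a b hab hna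
    by_cases h1 : a = v
    · subst h1
      rw [Function.update_self, Function.update_of_ne hab.ne']
      intro h
      exact hcon b h.symm hab.symm
    · by_cases h2 : b = v
      · subst h2
        rw [Function.update_self, Function.update_of_ne h1]
        intro h
        exact hcon a h hab
      · rw [Function.update_of_ne h1] at hna ⊢
        rw [Function.update_of_ne h2]
        exact hf' a b hab hna
  have hlt : (Finset.univ.filter (fun u => Function.update f v (some j) u = none)).card
      < (Finset.univ.filter (fun u => f u = none)).card := by
    apply Finset.card_lt_card
    rw [Finset.ssubset_iff_of_subset]
    · exact ⟨v, by simp [hv], by simp⟩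
    · intro u
      simp only [Finset.mem_filter, Finset.mem_univ, true_and]
      by_cases h : u = v
      · subst h; simp
      · rw [Function.update_of_ne h]; exact id
  exact absurd (hmin _ hg) (by simpa using hlt)

open Classical in
lemma det_color {V : Type*} [Fintype V] (G : SimpleGraph V) (k s : ℕ) (hk : 0 < k)
    (h1 : ∀ U : Finset V, U.Nonempty → U.card ≤ s →
      ∃ v ∈ U, (U.filter (fun u => G.Adj v u)).card < k)
    (h2 : ∀ f : V → Option (Fin k),
      (∀ v, f v = none → ∀ j : Fin k, ∃ u, f u = some j ∧ G.Adj u v) →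
      (Finset.univ.filter (fun v => f v = none)).card ≤ s) :
    ∃ C : V → Fin k ⊕ Fin k, ∀ u v, G.Adj u v → C u ≠ C v := by
  obtain ⟨f, hf, hm⟩ := max_partial G k
  obtain ⟨c, hc⟩ := degen_color G k s h1 hk _ (h2 f hm)
  refine ⟨fun v => (f v).elim (Sum.inl (c v)) Sum.inr, ?_⟩
  intro u v huv
  have h3 := hf u v huv
  cases hu : f u with
  | none =>
    cases hv : f v with
    | none =>
      have := hc u (by simp [hu]) v (by simp [hv]) huv
      simpa [hu, hv] using this
    | some j => simp [hu, hv]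
  | some i =>
    cases hv : f v with
    | none => simp [hu, hv]
    | some j =>
      have := h3 (by simp [hu])
      rw [hu, hv] at this
      simpa [hu, hv] using this

lemma deg_edges {n : ℕ} (ω : Sym2 (Fin n) → Bool) (U : Finset (Fin n)) (k : ℕ)
    (h : ∀ v ∈ U, k ≤ (U.filter (fun u => (graphOf ω).Adj v u)).card) :
    U.card * k ≤ 2 * (U.sym2.filter (fun e => ω e = true)).card := by
  classical
  let H : SimpleGraph (Fin n) :=
    { Adj := fun u v => (graphOf ω).Adj u v ∧ u ∈ U ∧ v ∈ U
      symm := ⟨fun u v h => ⟨h.1.symm, h.2.2, h.2.1⟩⟩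
      loopless := ⟨fun v h => (graphOf ω).loopless.irrefl v h.1⟩ }
  have h1 := H.sum_degrees_eq_twice_card_edges
  have h2 : H.edgeFinset ⊆ U.sym2.filter (fun e => ω e = true) := by
    intro e
    induction e using Sym2.ind with
    | h u v =>
      intro he
      rw [SimpleGraph.mem_edgeFinset, SimpleGraph.mem_edgeSet] at he
      simp only [Finset.mem_filter, Finset.mk_mem_sym2_iff]
      exact ⟨he.2, he.1.2⟩
  have h3 := Finset.card_le_card h2
  have h4 : U.card * k ≤ ∑ v, H.degree v := by
    calc U.card * k = ∑ v ∈ U, k := by simp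
      _ ≤ ∑ v ∈ U, H.degree v := by
        apply Finset.sum_le_sum
        intro v hv
        refine (h v hv).trans ?_
        rw [← SimpleGraph.card_neighborFinset_eq_degree]
        apply Finset.card_le_card
        intro u hu
        rw [Finset.mem_filter] at hu
        rw [SimpleGraph.mem_neighborFinset]
        exact ⟨hu.2, hv, hu.1⟩
      _ ≤ ∑ v, H.degree v :=
        Finset.sum_le_sum_of_subset (Finset.subset_univ _)
  omega

lemma sum_pow_card (n : ℕ) (w : ℝ) :
    ∑ U ∈ (Finset.univ : Finset (Finset (Fin n))).filter (fun U => U.Nonempty), w ^ U.card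
      = (1 + w) ^ n - 1 := by
  have h := Fintype.sum_pow_mul_eq_add_pow (Fin n) w 1
  simp only [one_pow, mul_one, Fintype.card_fin] at h
  have h2 : (Finset.univ : Finset (Finset (Fin n))).filter (fun U => U.Nonempty)
      = Finset.univ.erase ∅ := by
    ext U; simp [Finset.nonempty_iff_ne_empty]
  rw [h2, ← add_comm w, ← h, ← Finset.add_sum_erase Finset.univ _ (Finset.mem_univ ∅)]
  simp

lemma prob_A1 (n : ℕ) (p : ℝ) (hp0 : 0 ≤ p) (hp1 : p ≤ 1) (k s : ℕ) (l : ℝ) (hl : 0 ≤ l) :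
    (erdosRenyi n p).real {ω | ∃ U : Finset (Fin n), U.Nonempty ∧ U.card ≤ s ∧
      ∀ v ∈ U, k ≤ (U.filter (fun u => (graphOf ω).Adj v u)).card}
      ≤ (1 + Real.exp (Real.exp l * p * s - l * k / 2)) ^ n - 1 := by
  have := er_prob n p hp0 hp1
  set w := Real.exp (Real.exp l * p * s - l * k / 2) with hw
  let X : Finset (Finset (Fin n)) := Finset.univ.filter (fun U => U.Nonempty)
  let Bd : Finset (Fin n) → Set (Sym2 (Fin n) → Bool) := fun U =>
    {ω | U.card ≤ s ∧ ∀ v ∈ U, k ≤ (U.filter (fun u => (graphOf ω).Adj v u)).card}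
  have hsub : {ω : Sym2 (Fin n) → Bool | ∃ U : Finset (Fin n), U.Nonempty ∧ U.card ≤ s ∧
      ∀ v ∈ U, k ≤ (U.filter (fun u => (graphOf ω).Adj v u)).card} ⊆ ⋃ U ∈ X, Bd U := by
    rintro ω ⟨U, h1, h2, h3⟩
    simp only [Set.mem_iUnion]
    exact ⟨U, by simpa [X] using h1, h2, h3⟩
  refine (measureReal_mono hsub (measure_ne_top _ _)).trans ((measureReal_biUnion_finset_le _ _).trans ?_)
  rw [← sum_pow_card]
  apply Finset.sum_le_sum
  intro U hU
  by_cases hs : U.card ≤ s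
  swap
  · have : Bd U = ∅ := by
      ext ω
      simp [Bd, hs]
    rw [this]
    simp only [measureReal_empty]
    positivity
  have h1 : Bd U ⊆ {ω | (U.card * k / 2 : ℝ) ≤
      (((U.sym2.filter (fun e => ω e = true)).card : ℕ) : ℝ)} := by
    rintro ω ⟨_, h⟩
    have := deg_edges ω U k h
    have h' : ((U.card * k : ℕ) : ℝ) ≤ ((2 * (U.sym2.filter (fun e => ω e = true)).card : ℕ) : ℝ) := by
      exact_mod_cast this
    push_cast at h'
    show (U.card * k / 2 : ℝ) ≤ _
    linarith
  refine (measureReal_mono h1).trans ((prob_many n p hp0 hp1 _ l hl _).trans ?_)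
  rw [hw, ← Real.exp_nat_mul]
  apply Real.exp_le_exp.2
  have h2 : U.sym2.card ≤ U.card * s := by
    rw [Finset.card_sym2]
    have h3 : (U.card + 1).choose 2 ≤ U.card * U.card := by
      rw [Nat.choose_two_right]
      apply Nat.div_le_of_le_mul
      simp only [Nat.add_sub_cancel]
      rcases Nat.eq_zero_or_pos U.card with h0 | h0
      · simp [h0]
      · nlinarith
    exact h3.trans (Nat.mul_le_mul_left _ hs)
  have h3 : (U.sym2.card : ℝ) ≤ U.card * s := by exact_mod_cast h2
  have h4 : Real.exp l * p * U.sym2.card ≤ Real.exp l * p * (U.card * s) :=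
    mul_le_mul_of_nonneg_left h3 (mul_nonneg (Real.exp_pos l).le hp0)
  linarith

lemma one_sub_ge (p : ℝ) (hp0 : 0 ≤ p) (hp1 : p ≤ 0.99) : Real.exp (-(100 * p)) ≤ 1 - p := by
  have h := Real.one_sub_inv_le_log_of_pos (show (0:ℝ) < 1 - p by linarith)
  have h1 : (1 - p)⁻¹ ≤ 1 + 100 * p := by
    rw [inv_le_iff_one_le_mul₀ (by linarith)]
    nlinarith
  calc Real.exp (-(100 * p)) ≤ Real.exp (Real.log (1 - p)) := Real.exp_le_exp.2 (by linarith)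
    _ = 1 - p := Real.exp_log (by linarith)

lemma prob_A2 (n : ℕ) (p : ℝ) (hp0 : 0 ≤ p) (hp1 : p ≤ 0.99) (k s : ℕ) (x : ℝ)
    (hx : 100 * p * n ≤ k * x) :
    (erdosRenyi n p).real {ω | ∃ f : Fin n → Option (Fin k),
      (∀ v, f v = none → ∀ j : Fin k, ∃ u, f u = some j ∧ (graphOf ω).Adj u v) ∧
      s < (Finset.univ.filter (fun v => f v = none)).card}
      ≤ ((k : ℝ) + 1) ^ n * Real.exp (- (s * (k * Real.exp (-x)))) := by
  have hp1' : p ≤ 1 := by linarith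
  have := er_prob n p hp0 hp1'
  let Bd : (Fin n → Option (Fin k)) → Set (Sym2 (Fin n) → Bool) := fun f =>
    {ω | (∀ v, f v = none → ∀ j : Fin k, ∃ u, f u = some j ∧ (graphOf ω).Adj u v) ∧
      s < (Finset.univ.filter (fun v => f v = none)).card}
  have hsub : {ω : Sym2 (Fin n) → Bool | ∃ f : Fin n → Option (Fin k),
      (∀ v, f v = none → ∀ j : Fin k, ∃ u, f u = some j ∧ (graphOf ω).Adj u v) ∧
      s < (Finset.univ.filter (fun v => f v = none)).card} ⊆
      ⋃ f ∈ (Finset.univ : Finset (Fin n → Option (Fin k))), Bd f := by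
    rintro ω ⟨f, h⟩
    simp only [Set.mem_iUnion]
    exact ⟨f, Finset.mem_univ _, h⟩
  refine (measureReal_mono hsub (measure_ne_top _ _)).trans ((measureReal_biUnion_finset_le _ _).trans ?_)
  have hcard : ((k : ℝ) + 1) ^ n = ((Finset.univ : Finset (Fin n → Option (Fin k))).card : ℝ) := by
    rw [Finset.card_univ, Fintype.card_fun]
    simp
  rw [hcard, ← nsmul_eq_mul]
  apply Finset.sum_le_card_nsmul
  intro f _
  set F := Finset.univ.filter (fun v => f v = none) with hF
  by_cases hs : s < F.card
  swap
  · have : Bd f = ∅ := by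
      ext ω
      simp only [Bd, Set.mem_ofPred_eq, Set.mem_empty_iff_false, iff_false, not_and]
      intro _
      exact hs
    rw [this]
    simp only [measureReal_empty]
    positivity
  let Cl : Fin k → Finset (Fin n) := fun j => Finset.univ.filter (fun u => f u = some j)
  let T : Fin n × Fin k → Finset (Sym2 (Fin n)) := fun i => (Cl i.2).image (fun u => s(u, i.1))
  let I : Finset (Fin n × Fin k) := F ×ˢ Finset.univ
  have hdis : Set.PairwiseDisjoint (I : Set (Fin n × Fin k)) T := by
    rintro ⟨v, j⟩ hv ⟨v', j'⟩ hv' hne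
    simp only [I, F, Finset.coe_product, Set.mem_prod, Finset.mem_coe, Finset.mem_filter,
      Finset.mem_univ, true_and, and_true] at hv hv'
    simp only [Function.onFun]
    rw [Finset.disjoint_left]
    intro e he he'
    simp only [T, Cl, Finset.mem_image, Finset.mem_filter, Finset.mem_univ, true_and] at he he'
    obtain ⟨u, hu, rfl⟩ := he
    obtain ⟨u', hu', h⟩ := he'
    rw [Sym2.eq_iff] at h
    rcases h with ⟨h1, h2⟩ | ⟨h1, h2⟩
    · subst h1; subst h2
      rw [hu] at hu'
      simp only [Option.some.injEq] at hu'
      exact hne (by rw [hu'])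
    · subst h1
      rw [hv] at hu'
      simp at hu'
  have hTc : ∀ i, (T i).card = (Cl i.2).card := by
    intro i
    apply Finset.card_image_of_injective
    intro a b hab
    exact Sym2.congr_left.1 hab
  have hsub2 : Bd f ⊆ {ω | ∀ i ∈ I, ∃ e ∈ T i, ω e = true} := by
    rintro ω ⟨h, _⟩ ⟨v, j⟩ hi
    simp only [I, F, Finset.mem_product, Finset.mem_filter,
      Finset.mem_univ, true_and, and_true] at hi
    obtain ⟨u, hu, hadj⟩ := h v hi j
    refine ⟨s(u, v), ?_, hadj.2⟩
    simp only [T, Cl, Finset.mem_image, Finset.mem_filter, Finset.mem_univ, true_and]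
    exact ⟨u, hu, rfl⟩
  refine (measureReal_mono hsub2).trans ((prob_hit n p hp0 hp1' I T hdis).trans ?_)
  have hq : ∀ c : ℕ, Real.exp (-x) * (1 + x - 100 * p * c) ≤ (1 - p) ^ c := by
    intro c
    calc Real.exp (-x) * (1 + x - 100 * p * c)
        ≤ Real.exp (-x) * Real.exp (x - 100 * p * c) := by
          apply mul_le_mul_of_nonneg_left _ (Real.exp_pos _).le
          have := Real.add_one_le_exp (x - 100 * p * c)
          linarith
      _ = Real.exp (-(100 * p)) ^ c := by
          rw [← Real.exp_add, ← Real.exp_nat_mul]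
          congr 1; ring
      _ ≤ (1 - p) ^ c := pow_le_pow_left₀ (Real.exp_pos _).le (one_sub_ge p hp0 hp1) _
  have hsumc : ∑ j, ((Cl j).card : ℝ) ≤ n := by
    have h1 : (∑ j, (Cl j).card) = (Finset.univ.biUnion Cl).card := by
      rw [Finset.card_biUnion]
      intro a _ b _ hab
      show Disjoint (Cl a) (Cl b)
      rw [Finset.disjoint_left]
      intro u hu hu'
      simp only [Cl, Finset.mem_filter, Finset.mem_univ, true_and] at hu hu'
      rw [hu] at hu'
      exact hab (by simpa using hu')
    have h2 : (Finset.univ.biUnion Cl).card ≤ n := by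
      simpa using Finset.card_le_univ (Finset.univ.biUnion Cl)
    rw [← h1] at h2
    exact_mod_cast h2
  have hsum : k * Real.exp (-x) ≤ ∑ j, (1 - p) ^ (Cl j).card := by
    calc k * Real.exp (-x) ≤ Real.exp (-x) * (k * (1 + x) - 100 * p * ∑ j, ((Cl j).card : ℝ)) := by
          rw [mul_comm]
          apply mul_le_mul_of_nonneg_left _ (Real.exp_pos _).le
          have := mul_le_mul_of_nonneg_left hsumc (show 0 ≤ 100 * p by linarith)
          linarith
      _ = ∑ j, Real.exp (-x) * (1 + x - 100 * p * (Cl j).card) := by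
          rw [← Finset.mul_sum, Finset.sum_sub_distrib, ← Finset.mul_sum]
          simp [mul_add]
      _ ≤ _ := Finset.sum_le_sum (fun j _ => hq _)
  calc ∏ i ∈ I, (1 - (1 - p) ^ (T i).card)
      ≤ ∏ i ∈ I, Real.exp (-(1 - p) ^ (Cl i.2).card) := by
        apply Finset.prod_le_prod
        · intro i _
          have := pow_le_one₀ (n := (T i).card) (show 0 ≤ 1 - p by linarith) (by linarith)
          linarith
        · intro i _
          rw [hTc]
          exact Real.one_sub_le_exp_neg _
    _ = Real.exp (-(F.card * ∑ j, (1 - p) ^ (Cl j).card)) := by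
        rw [← Real.exp_sum]
        congr 1
        simp only [I]
        rw [Finset.sum_product]
        simp
    _ ≤ _ := by
        apply Real.exp_le_exp.2
        apply neg_le_neg
        have hs' : (s : ℝ) ≤ F.card := by exact_mod_cast hs.le
        apply mul_le_mul hs' hsum (by positivity) (by positivity)

open Classical in
lemma prob_B (n : ℕ) (p : ℝ) (hp0 : 0 ≤ p) (hp1 : p ≤ 1) (K : ℕ) :
    (erdosRenyi n p).real {ω | 2 ^ n ≤
      Nat.card {S : Set (Fin n) // ¬ LegalState (graphOf ω) S} * 2 ^ K}
      ≤ 2 * 2 ^ K / 2 ^ n * (1 + ∑ x ∈ pairsOf n, (1 - p) ^ (x.1.card * x.2.card)) := by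
  have := er_prob n p hp0 hp1
  let Ev : Finset (Fin n) × Finset (Fin n) → Set (Sym2 (Fin n) → Bool) := fun x =>
    {ω | ∀ a ∈ x.1, ∀ b ∈ x.2, ¬ (graphOf ω).Adj a b}
  have hE : ∀ x ∈ pairsOf n, (erdosRenyi n p).real (Ev x) ≤ (1 - p) ^ (x.1.card * x.2.card) := by
    intro x hx
    simp only [pairsOf, Finset.mem_filter, Finset.mem_univ, true_and] at hx
    let T : Finset (Sym2 (Fin n)) := (x.1 ×ˢ x.2).image (fun y => s(y.1, y.2))
    have hT : T.card = x.1.card * x.2.card := by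
      rw [← Finset.card_product]
      apply Finset.card_image_of_injOn
      rintro ⟨a, b⟩ hab ⟨a', b'⟩ hab' h
      simp only [Finset.coe_product, Set.mem_prod, Finset.mem_coe] at hab hab'
      simp only [Sym2.eq_iff] at h
      rcases h with ⟨rfl, rfl⟩ | ⟨rfl, rfl⟩
      · rfl
      · exact absurd hab'.2 (Finset.disjoint_left.1 hx.1 hab.1)
    rw [← hT]
    refine (measureReal_mono ?_).trans (prob_none n p hp0 hp1 T)
    intro ω hω e he
    simp only [T, Finset.mem_image, Finset.mem_product] at he
    obtain ⟨⟨a, b⟩, ⟨ha, hb⟩, rfl⟩ := he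
    have h1 := hω a ha b hb
    have hne : a ≠ b := fun h => Finset.disjoint_left.1 hx.1 ha (h ▸ hb)
    by_contra h2
    exact h1 ⟨hne, by simpa using h2⟩
  have h1 := real_le_E n p hp0 hp1 {ω | 2 ^ n ≤
      Nat.card {S : Set (Fin n) // ¬ LegalState (graphOf ω) S} * 2 ^ K}
      (fun ω => 2 * 2 ^ K / 2 ^ n * (1 + ∑ x ∈ pairsOf n, (Ev x).indicator 1 ω))
      (by
        intro ω
        have : 0 ≤ ∑ x ∈ pairsOf n, (Ev x).indicator (1 : (Sym2 (Fin n) → Bool) → ℝ) ω :=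
          Finset.sum_nonneg (fun x _ => Set.indicator_nonneg (by simp) _)
        positivity)
      (by
        intro ω hω
        obtain ⟨c, h3, h2⟩ : ∃ c : ℕ,
            (c : ℝ) = ∑ x ∈ pairsOf n, (Ev x).indicator (1 : (Sym2 (Fin n) → Bool) → ℝ) ω ∧
            Nat.card {S : Set (Fin n) // ¬ LegalState (graphOf ω) S} ≤ 2 * (1 + c) := by
          refine ⟨_, ?_, illegal_count n (graphOf ω)⟩
          rw [Finset.card_filter]
          push_cast
          apply Finset.sum_congr rfl
          intro x _
          simp [Set.indicator_apply, Ev]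
        rw [← h3]
        have h4 : 2 ^ n ≤ Nat.card {S : Set (Fin n) // ¬ LegalState (graphOf ω) S} * 2 ^ K := hω
        have h5 := h4.trans (Nat.mul_le_mul_right (2 ^ K) h2)
        have h6 : ((2 : ℝ) ^ n) ≤ 2 * (1 + (c : ℝ)) * 2 ^ K := by
          exact_mod_cast h5
        rw [div_mul_eq_mul_div, le_div_iff₀ (by positivity)]
        linarith)
  refine h1.trans ?_
  rw [integral_const_mul]
  apply mul_le_mul_of_nonneg_left _ (by positivity)
  rw [integral_add Integrable.of_finite Integrable.of_finite,
    integral_finsetSum _ (fun _ _ => Integrable.of_finite)]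
  simp only [integral_const, probReal_univ, smul_eq_mul, mul_one]
  gcongr with x hx
  rw [integral_indicator_one (Set.toFinite _).measurableSet]
  exact hE x hx

lemma half_bound (n a : ℕ) (p : ℝ) (hp0 : 0 ≤ p) (hp1 : p ≤ 1) (ha : 1000 * a ≤ n) :
    ((1 + (1 - p) ^ a) / 2) ^ (n - a) ≤
      Real.exp (-(0.449 * (p * n))) ^ a + Real.exp (-(0.165 * n)) * Real.exp (-5) ^ a := by
  have haR : (1000 * a : ℝ) ≤ n := by exact_mod_cast ha
  have hcast : ((n - a : ℕ) : ℝ) = n - a := by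
    rw [Nat.cast_sub (by omega)]
  set x : ℝ := p * a with hx
  have hx0 : 0 ≤ x := by positivity
  have hq : (1 - p) ^ a ≤ Real.exp (-x) := by
    calc (1 - p) ^ a ≤ Real.exp (-p) ^ a :=
          pow_le_pow_left₀ (by linarith) (Real.one_sub_le_exp_neg p) a
      _ = Real.exp (-x) := by rw [← Real.exp_nat_mul]; congr 1; rw [hx]; ring
  have hq0 : 0 ≤ (1 - p) ^ a := pow_nonneg (by linarith) _
  have hcosh : ∀ y : ℝ, (1 + Real.exp (-y)) / 2 ≤ Real.exp (-y / 2 + y ^ 2 / 8) := by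
    intro y
    have h1 := Real.cosh_le_exp_half_sq (y / 2)
    rw [Real.cosh_eq] at h1
    have h2 := mul_le_mul_of_nonneg_left h1 (Real.exp_pos (-y / 2)).le
    rw [← Real.exp_add] at h2
    calc (1 + Real.exp (-y)) / 2
        = Real.exp (-y / 2) * ((Real.exp (y / 2) + Real.exp (-(y / 2))) / 2) := by
          rw [mul_div_assoc', mul_add, ← Real.exp_add, ← Real.exp_add,
            show -y / 2 + y / 2 = 0 by ring, show -y / 2 + -(y / 2) = -y by ring, Real.exp_zero]
      _ ≤ _ := h2
      _ = _ := by congr 1; ring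
  have key : ∀ c : ℝ, (1 + Real.exp (-x)) / 2 ≤ Real.exp (-c) →
      ((1 + (1 - p) ^ a) / 2) ^ (n - a) ≤ Real.exp (-(c * (n - a))) := by
    intro c hc
    calc ((1 + (1 - p) ^ a) / 2) ^ (n - a) ≤ Real.exp (-c) ^ (n - a) :=
          pow_le_pow_left₀ (by linarith) (by linarith) _
      _ = _ := by rw [← Real.exp_nat_mul, hcast]; congr 1; ring
  rcases le_total x 0.4 with h | h
  · have h1 := key (0.45 * x) ((hcosh x).trans (Real.exp_le_exp.2 (by nlinarith)))
    have h2 : Real.exp (-(0.45 * x * (n - a))) ≤ Real.exp (-(0.449 * (p * n))) ^ a := by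
      rw [← Real.exp_nat_mul]
      apply Real.exp_le_exp.2
      have : (a : ℝ) * -(0.449 * (p * n)) = -(0.449 * x * n) := by rw [hx]; ring
      rw [this]
      nlinarith
    have : 0 ≤ Real.exp (-(0.165 * n)) * Real.exp (-5) ^ a := by positivity
    linarith
  · have h1 := key 0.18 (by
      have h3 : Real.exp (-x) ≤ Real.exp (-0.4) := Real.exp_le_exp.2 (by linarith)
      calc (1 + Real.exp (-x)) / 2 ≤ (1 + Real.exp (-0.4)) / 2 := by linarith
        _ ≤ _ := (hcosh 0.4).trans (Real.exp_le_exp.2 (by norm_num)))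
    have h2 : Real.exp (-(0.18 * (n - a))) ≤ Real.exp (-(0.165 * n)) * Real.exp (-5) ^ a := by
      rw [← Real.exp_nat_mul, ← Real.exp_add]
      apply Real.exp_le_exp.2
      linarith
    have : 0 ≤ Real.exp (-(0.449 * (p * n))) ^ a := by positivity
    linarith

lemma sum_disj (n : ℕ) (A : Finset (Fin n)) (y : ℝ) :
    ∑ B : Finset (Fin n), (if Disjoint A B then y ^ B.card else 0) = (1 + y) ^ (n - A.card) := by
  rw [← Finset.sum_filter]
  have h : (Finset.univ : Finset (Finset (Fin n))).filter (fun B => Disjoint A B)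
      = (Aᶜ).powerset := by
    ext B
    simp only [Finset.mem_filter, Finset.mem_univ, true_and, Finset.mem_powerset,
      Finset.subset_compl_iff_disjoint_left]
  rw [h]
  have := Finset.sum_pow_mul_eq_add_pow y 1 (Aᶜ)
  simp only [one_pow, mul_one, Finset.card_compl, Fintype.card_fin] at this
  rw [this, add_comm]

lemma sumB (n : ℕ) (p : ℝ) (hp0 : 0 ≤ p) (hp1 : p ≤ 1) :
    (∑ x ∈ pairsOf n, (1 - p) ^ (x.1.card * x.2.card)) / 2 ^ n ≤
      ((1 + Real.exp (-(0.449 * (p * n)))) ^ n - 1) + Real.exp (-(0.13 * n))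
        + 2 ^ n * Real.exp (-(p * n * n / 1000000)) := by
  set E := Real.exp (-(p * n * n / 1000000)) with hE
  set z := Real.exp (-(0.449 * (p * n))) with hz
  have hq0 : 0 ≤ 1 - p := by linarith
  have h1 : ∑ x ∈ pairsOf n, (1 - p) ^ (x.1.card * x.2.card) ≤
      ∑ x : Finset (Fin n) × Finset (Fin n),
        ((if x.1.Nonempty ∧ 1000 * x.1.card ≤ n then
          (if Disjoint x.1 x.2 then ((1 - p) ^ x.1.card) ^ x.2.card else 0) else 0) + E) := by
    have hnn : ∀ x : Finset (Fin n) × Finset (Fin n),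
        0 ≤ (if x.1.Nonempty ∧ 1000 * x.1.card ≤ n then
          (if Disjoint x.1 x.2 then ((1 - p) ^ x.1.card) ^ x.2.card else 0) else 0) := by
      intro x
      split_ifs <;> positivity
    have hE0 : 0 < E := Real.exp_pos _
    refine le_trans (Finset.sum_le_sum ?_)
      (Finset.sum_le_sum_of_subset_of_nonneg (Finset.subset_univ (pairsOf n))
        (fun x _ _ => add_nonneg (hnn x) hE0.le))
    intro x hx
    simp only [pairsOf, Finset.mem_filter, Finset.mem_univ, true_and] at hx
    obtain ⟨hd, hne, hc⟩ := hx
    by_cases h : 1000 * x.1.card ≤ n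
    · rw [if_pos ⟨hne, h⟩, if_pos hd, ← pow_mul]
      linarith
    · refine le_trans ?_ (le_add_of_nonneg_left (hnn x))
      have ha : (n : ℝ) ≤ 1000 * x.1.card := by exact_mod_cast (not_le.1 h).le
      have hb : (x.1.card : ℝ) ≤ x.2.card := by exact_mod_cast hc
      have hb' : (n : ℝ) ≤ 1000 * x.2.card := by linarith
      calc (1 - p) ^ (x.1.card * x.2.card) ≤ Real.exp (-p) ^ (x.1.card * x.2.card) :=
            pow_le_pow_left₀ hq0 (Real.one_sub_le_exp_neg p) _
        _ ≤ E := by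
            rw [← Real.exp_nat_mul, hE]
            apply Real.exp_le_exp.2
            push_cast
            have h5 : (n : ℝ) * n ≤ (1000 * x.1.card) * (1000 * x.2.card) :=
              mul_le_mul ha hb' (by positivity) (by positivity)
            have h6 := mul_le_mul_of_nonneg_left h5 hp0
            linarith
  have h2 : ∑ x : Finset (Fin n) × Finset (Fin n),
        ((if x.1.Nonempty ∧ 1000 * x.1.card ≤ n then
          (if Disjoint x.1 x.2 then ((1 - p) ^ x.1.card) ^ x.2.card else 0) else 0) + E)
      = (∑ A : Finset (Fin n), if A.Nonempty ∧ 1000 * A.card ≤ n then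
          (1 + (1 - p) ^ A.card) ^ (n - A.card) else 0) + 2 ^ n * 2 ^ n * E := by
    rw [Finset.sum_add_distrib]
    congr 1
    · rw [Fintype.sum_prod_type]
      apply Finset.sum_congr rfl
      intro A _
      split_ifs with h
      · exact sum_disj n A ((1 - p) ^ A.card)
      · simp
    · simp [Finset.card_univ]
  have h3 : ∀ A : Finset (Fin n), (if A.Nonempty ∧ 1000 * A.card ≤ n then
          (1 + (1 - p) ^ A.card) ^ (n - A.card) else 0) / 2 ^ n ≤
        (if A.Nonempty then z ^ A.card else 0)
          + Real.exp (-(0.165 * n)) * Real.exp (-5) ^ A.card := by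
    intro A
    by_cases h : A.Nonempty ∧ 1000 * A.card ≤ n
    · rw [if_pos h, if_pos h.1]
      refine le_trans ?_ (half_bound n A.card p hp0 hp1 h.2)
      rw [div_pow]
      have := pow_nonneg hq0 A.card
      apply div_le_div_of_nonneg_left (by positivity) (by positivity)
      exact pow_le_pow_right₀ (by norm_num) (by omega)
    · rw [if_neg h]
      simp only [zero_div]
      split_ifs <;> positivity
  have h4 : ∑ A : Finset (Fin n), Real.exp (-5) ^ A.card = (1 + Real.exp (-5)) ^ n := by
    have h := Fintype.sum_pow_mul_eq_add_pow (Fin n) (Real.exp (-5)) 1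
    simp only [one_pow, mul_one, Fintype.card_fin] at h
    rw [h, add_comm]
  have h5 : (1 + Real.exp (-5)) ^ n ≤ Real.exp (0.035 * n) := by
    have he : Real.exp (-5) ≤ 0.035 := by
      rw [Real.exp_neg, inv_le_comm₀ (Real.exp_pos _) (by norm_num)]
      have h2 : (2 : ℝ) ≤ Real.exp 1 := by
        have := Real.add_one_le_exp (1 : ℝ); linarith
      have h3 : (2 : ℝ) ^ 5 ≤ Real.exp 1 ^ 5 := pow_le_pow_left₀ (by norm_num) h2 5
      rw [← Real.exp_nat_mul] at h3
      norm_num at h3 ⊢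
      linarith
    rw [mul_comm, Real.exp_nat_mul]
    apply pow_le_pow_left₀ (by positivity)
    have := Real.add_one_le_exp (0.035 : ℝ)
    linarith
  calc (∑ x ∈ pairsOf n, (1 - p) ^ (x.1.card * x.2.card)) / 2 ^ n
      ≤ ((∑ A : Finset (Fin n), if A.Nonempty ∧ 1000 * A.card ≤ n then
          (1 + (1 - p) ^ A.card) ^ (n - A.card) else 0) + 2 ^ n * 2 ^ n * E) / 2 ^ n := by
        apply div_le_div_of_nonneg_right _ (by positivity)
        rw [← h2]; exact h1
    _ = (∑ A : Finset (Fin n), (if A.Nonempty ∧ 1000 * A.card ≤ n then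
          (1 + (1 - p) ^ A.card) ^ (n - A.card) else 0) / 2 ^ n) + 2 ^ n * E := by
        rw [add_div, Finset.sum_div]
        congr 1
        field_simp
    _ ≤ (∑ A : Finset (Fin n), ((if A.Nonempty then z ^ A.card else 0)
          + Real.exp (-(0.165 * n)) * Real.exp (-5) ^ A.card)) + 2 ^ n * E := by
        gcongr with A _
        exact h3 A
    _ = ((1 + z) ^ n - 1) + Real.exp (-(0.165 * n)) * (1 + Real.exp (-5)) ^ n + 2 ^ n * E := by
        rw [Finset.sum_add_distrib, ← Finset.sum_filter, sum_pow_card, ← Finset.mul_sum, h4]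
    _ ≤ _ := by
        have : Real.exp (-(0.165 * n)) * (1 + Real.exp (-5)) ^ n ≤ Real.exp (-(0.13 * n)) := by
          refine (mul_le_mul_of_nonneg_left h5 (Real.exp_pos _).le).trans ?_
          rw [← Real.exp_add]
          apply Real.exp_le_exp.2
          linarith
        linarith

lemma pow_sub_one_le (n : ℕ) (w : ℝ) (hw : 0 ≤ w) (h : n * w ≤ 1) :
    (1 + w) ^ n - 1 ≤ 2 * (n * w) := by
  have h1 : (1 + w) ^ n ≤ Real.exp (n * w) := by
    rw [Real.exp_nat_mul]
    apply pow_le_pow_left₀ (by linarith)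
    have := Real.add_one_le_exp w
    linarith
  have h0 : 0 ≤ n * w := by positivity
  have h2 := Real.abs_exp_sub_one_le (x := n * w) (by rw [abs_of_nonneg h0]; exact h)
  rw [abs_of_nonneg h0] at h2
  have := le_abs_self (Real.exp (n * w) - 1)
  linarith

set_option maxHeartbeats 4000000 in
lemma core_exists : ∃ D : ℝ, ∀ (n : ℕ) (p : ℝ), D ≤ Real.log n → 3 * Real.log n ≤ p * n →
    p ≤ 0.99 → (erdosRenyi n p).real {ω | ¬ HasLegalSystem (graphOf ω)}
      ≤ 13 * Real.exp (-(0.08 * Real.log n)) := by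
  classical
  set σ : ℝ := Real.exp (-82) / 10 with hσ
  have hσ0 : 0 < σ := by positivity
  set c : ℝ := σ / 2 * Real.exp (-4100) with hc
  have hc0 : 0 < c := by positivity
  have hlog : ∃ N : ℝ, ∀ k : ℕ, N ≤ k → Real.log (k + 1) ≤ c * k - 1 := by
    have h1 := Real.isLittleO_log_id_atTop.def (show 0 < c / 2 by positivity)
    obtain ⟨N, hN⟩ := Filter.eventually_atTop.1 h1
    refine ⟨max (max N 0) (2 / c + 1), fun k hk => ?_⟩
    have hk1 : N ≤ (k : ℝ) + 1 := by
      have := (le_max_left N 0).trans ((le_max_left _ _).trans hk); linarith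
    have hk2 : 2 / c + 1 ≤ (k : ℝ) := (le_max_right _ _).trans hk
    have h2 := hN _ hk1
    simp only [id, Real.norm_eq_abs] at h2
    have h3 := le_abs_self (Real.log ((k : ℝ) + 1))
    rw [abs_of_nonneg (show (0 : ℝ) ≤ (k : ℝ) + 1 by positivity)] at h2
    have h4 : 2 + c ≤ c * k := by
      have := mul_le_mul_of_nonneg_left hk2 hc0.le
      rw [mul_add, mul_div_cancel₀ _ hc0.ne'] at this
      linarith
    nlinarith
  obtain ⟨N, hN⟩ := hlog
  refine ⟨max (10 ^ 7) (max (41 * N) (2 / σ)), ?_⟩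
  intro n p hD hd hp1
  have hD1 : (10 ^ 7 : ℝ) ≤ Real.log n := (le_max_left _ _).trans hD
  have hD2 : 41 * N ≤ Real.log n := (le_max_left _ _).trans ((le_max_right _ _).trans hD)
  have hD3 : 2 / σ ≤ Real.log n := (le_max_right _ _).trans ((le_max_right _ _).trans hD)
  set L := Real.log n with hL
  set d := p * n with hdd
  have hn0 : 0 < (n : ℝ) := by
    rcases Nat.eq_zero_or_pos n with h | h
    · rw [h] at hL; simp at hL; rw [hL] at hD1; norm_num at hD1
    · exact_mod_cast h
  have hnL : (n : ℝ) = Real.exp L := (Real.exp_log hn0).symm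
  have hLn : L ≤ n := by
    have := Real.add_one_le_exp L; linarith
  have hp0 : 0 ≤ p := by
    by_contra h
    have : d < 0 := mul_neg_of_neg_of_pos (not_le.1 h) hn0
    linarith
  have hp1' : p ≤ 1 := by linarith
  have hdn : d ≤ n := by
    have := mul_le_mul_of_nonneg_right hp1' hn0.le
    linarith
  have := er_prob n p hp0 hp1'
  set k : ℕ := ⌊d / 40⌋₊ with hk
  have hkle : (k : ℝ) ≤ d / 40 := Nat.floor_le (by linarith)
  have hkge : d / 41 ≤ k := by
    have := Nat.lt_floor_add_one (d / 40)
    linarith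
  have hkpos : 0 < k := by
    have : (0 : ℝ) < k := by linarith
    exact_mod_cast this
  set s : ℕ := ⌊σ * n⌋₊ with hs
  have hsle : (s : ℝ) ≤ σ * n := Nat.floor_le (by positivity)
  have hsge : σ / 2 * n ≤ s := by
    have h1 := Nat.lt_floor_add_one (σ * n)
    have h2 : 2 ≤ σ * n := by
      have := mul_le_mul_of_nonneg_left (hD3.trans hLn) hσ0.le
      rwa [mul_div_cancel₀ _ hσ0.ne'] at this
    linarith
  set A1 := {ω : Sym2 (Fin n) → Bool | ∃ U : Finset (Fin n), U.Nonempty ∧ U.card ≤ s ∧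
      ∀ v ∈ U, k ≤ (U.filter (fun u => (graphOf ω).Adj v u)).card} with hA1
  set A2 := {ω : Sym2 (Fin n) → Bool | ∃ f : Fin n → Option (Fin k),
      (∀ v, f v = none → ∀ j : Fin k, ∃ u, f u = some j ∧ (graphOf ω).Adj u v) ∧
      s < (Finset.univ.filter (fun v => f v = none)).card} with hA2
  set B := {ω : Sym2 (Fin n) → Bool | 2 ^ n ≤
      Nat.card {S : Set (Fin n) // ¬ LegalState (graphOf ω) S} * 2 ^ (2 * k)} with hB
  have hsub : {ω : Sym2 (Fin n) → Bool | ¬ HasLegalSystem (graphOf ω)} ⊆ (A1 ∪ A2) ∪ B := by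
    intro ω hω
    by_contra hcon
    simp only [Set.mem_union, not_or] at hcon
    obtain ⟨⟨h1, h2⟩, h3⟩ := hcon
    apply hω
    obtain ⟨C, hC⟩ := det_color (graphOf ω) k s hkpos
      (by
        intro U hU hUs
        by_contra hno
        push Not at hno
        refine h1 ⟨U, hU, hUs, fun v hv => ?_⟩
        exact (hno v hv).trans (le_of_eq (by congr)))
      (by
        intro f hf
        by_contra hno
        refine h2 ⟨f, hf, ?_⟩
        convert not_le.1 hno)
    refine det_legal (graphOf ω) C hC ?_
    have h4 : ¬ (2 ^ n ≤
      Nat.card {S : Set (Fin n) // ¬ LegalState (graphOf ω) S} * 2 ^ (2 * k)) := h3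
    rw [Fintype.card_sum, Fintype.card_fin, Fintype.card_fin, ← two_mul]
    exact not_le.1 h4
  have hmain : ∀ x : ℝ, x ≤ -(0.08 * L) → Real.exp x ≤ Real.exp (-(0.08 * L)) :=
    fun x hx => Real.exp_le_exp.2 hx
  set η := Real.exp (-(0.08 * L)) with hη
  have hnw : ∀ t : ℝ, (n : ℝ) * Real.exp t = Real.exp (L + t) := by
    intro t
    rw [hnL, ← Real.exp_add]
  -- A1
  have bA1 : (erdosRenyi n p).real A1 ≤ 2 * η := by
    refine (prob_A1 n p hp0 hp1' k s 82 (by norm_num)).trans ?_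
    set w := Real.exp (Real.exp 82 * p * s - 82 * k / 2) with hw
    have hww : w ≤ Real.exp (-(0.9 * d)) := by
      apply Real.exp_le_exp.2
      have h1 : Real.exp 82 * p * s ≤ Real.exp 82 * p * (σ * n) :=
        mul_le_mul_of_nonneg_left hsle (by positivity)
      have h2 : Real.exp 82 * p * (σ * n) = d / 10 := by
        have : Real.exp 82 * Real.exp (-82) = 1 := by rw [← Real.exp_add]; simp
        rw [hσ, hdd]
        calc Real.exp 82 * p * (Real.exp (-82) / 10 * n)
            = (Real.exp 82 * Real.exp (-82)) * (p * n) / 10 := by ring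
          _ = _ := by rw [this, one_mul]
      linarith
    have h3 : n * w ≤ Real.exp (L + -(0.9 * d)) := by
      rw [← hnw]
      exact mul_le_mul_of_nonneg_left hww hn0.le
    have h4 : n * w ≤ 1 := h3.trans (Real.exp_le_one_iff.2 (by linarith))
    have h5 := pow_sub_one_le n w (Real.exp_pos _).le h4
    have h6 := hmain (L + -(0.9 * d)) (by linarith)
    linarith
  have bA2 : (erdosRenyi n p).real A2 ≤ η := by
    refine (prob_A2 n p hp0 hp1 k s 4100 (by rw [mul_assoc, ← hdd]; linarith)).trans ?_
    have h1 := hN k (by linarith)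
    have h2 : ((k : ℝ) + 1) ^ n = Real.exp (n * Real.log (k + 1)) := by
      rw [Real.exp_nat_mul, Real.exp_log (by positivity)]
    rw [h2, ← Real.exp_add]
    apply hmain
    have h3 : σ / 2 * n * (k * Real.exp (-4100)) ≤ s * (k * Real.exp (-4100)) :=
      mul_le_mul_of_nonneg_right hsge (by positivity)
    have h4 : σ / 2 * n * (k * Real.exp (-4100)) = n * (c * k) := by rw [hc]; ring
    have h5 := mul_le_mul_of_nonneg_left h1 hn0.le
    linarith
  have bB : (erdosRenyi n p).real B ≤ 10 * η := by
    refine (prob_B n p hp0 hp1' (2 * k)).trans ?_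
    have h1 := sumB n p hp0 hp1'
    set Sg := ∑ x ∈ pairsOf n, (1 - p) ^ (x.1.card * x.2.card) with hSg
    have he : (2 : ℝ) ≤ Real.exp 1 := by
      have := Real.add_one_le_exp (1 : ℝ); linarith
    have h2K : (2 : ℝ) ^ (2 * k) ≤ Real.exp (d / 20) := by
      calc (2 : ℝ) ^ (2 * k) ≤ Real.exp 1 ^ (2 * k) := pow_le_pow_left₀ (by norm_num) he _
        _ = Real.exp (2 * k) := by rw [← Real.exp_nat_mul]; push_cast; congr 1; ring
        _ ≤ _ := Real.exp_le_exp.2 (by linarith)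
    have h2n : (2 : ℝ) ^ n ≤ Real.exp n := by
      calc (2 : ℝ) ^ n ≤ Real.exp 1 ^ n := pow_le_pow_left₀ (by norm_num) he _
        _ = _ := by rw [← Real.exp_nat_mul]; simp
    have h2n' : 1 / (2 : ℝ) ^ n ≤ Real.exp (-(n / 2)) := by
      have h3 : Real.exp (1 / 2) ≤ 2 := by
        have h4 : Real.exp (1 / 2) ^ 2 = Real.exp 1 := by
          rw [← Real.exp_nat_mul]; norm_num
        have := Real.exp_one_lt_d9
        nlinarith [Real.exp_pos (1 / 2 : ℝ)]
      rw [Real.exp_neg, one_div]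
      apply inv_anti₀ (Real.exp_pos _)
      calc Real.exp (n / 2) = Real.exp (1 / 2) ^ n := by
            rw [← Real.exp_nat_mul]; congr 1; ring
        _ ≤ 2 ^ n := pow_le_pow_left₀ (Real.exp_pos _).le h3 _
    have hz4 : (1 + Real.exp (-(0.449 * d))) ^ n - 1 ≤ 2 * Real.exp (L + -(0.449 * d)) := by
      have h3 : (n : ℝ) * Real.exp (-(0.449 * d)) ≤ 1 := by
        rw [hnw]
        exact Real.exp_le_one_iff.2 (by linarith)
      have := pow_sub_one_le n _ (Real.exp_pos _).le h3
      rwa [hnw] at this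
    have h6 : 2 ^ n * Real.exp (-(d * n / 1000000)) ≤ Real.exp (n + -(d * n / 1000000)) := by
      rw [Real.exp_add]
      exact mul_le_mul_of_nonneg_right h2n (Real.exp_pos _).le
    have h7 : (1 : ℝ) / 2 ^ n + Sg / 2 ^ n ≤ Real.exp (-(n / 2)) +
        (2 * Real.exp (L + -(0.449 * d)) + Real.exp (-(0.13 * n))
          + Real.exp (n + -(d * n / 1000000))) := by
      linarith
    have h8 : 0 ≤ Real.exp (-(n / 2 : ℝ)) +
        (2 * Real.exp (L + -(0.449 * d)) + Real.exp (-(0.13 * n))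
          + Real.exp (n + -(d * n / 1000000))) := by positivity
    have e1 := hmain (d / 20 + -(n / 2)) (by linarith)
    have e2 := hmain (d / 20 + (L + -(0.449 * d))) (by linarith)
    have e3 := hmain (d / 20 + -(0.13 * n)) (by linarith)
    have e4 := hmain (d / 20 + (n + -(d * n / 1000000))) (by nlinarith)
    rw [Real.exp_add] at e1 e2 e3 e4
    calc 2 * 2 ^ (2 * k) / 2 ^ n * (1 + Sg) = 2 * (2 ^ (2 * k) * (1 / 2 ^ n + Sg / 2 ^ n)) := by
          ring
      _ ≤ 2 * (Real.exp (d / 20) * (Real.exp (-(n / 2)) +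
        (2 * Real.exp (L + -(0.449 * d)) + Real.exp (-(0.13 * n))
          + Real.exp (n + -(d * n / 1000000))))) := by
          apply mul_le_mul_of_nonneg_left _ (by norm_num)
          exact (mul_le_mul_of_nonneg_left h7 (by positivity)).trans
            (mul_le_mul_of_nonneg_right h2K h8)
      _ ≤ 10 * η := by
          linarith
  have u1 := measureReal_mono (μ := erdosRenyi n p) hsub (measure_ne_top _ _)
  have u2 := measureReal_union_le (μ := erdosRenyi n p) (A1 ∪ A2) B
  have u3 := measureReal_union_le (μ := erdosRenyi n p) A1 A2
  linarith

theorem aas_gnp_has_legal_system_weak_range (p : ℕ → ℝ)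
    (hp : ∀ᶠ n : ℕ in atTop, 3 * Real.log n / n ≤ p n ∧ p n ≤ 0.99) :
    Tendsto (fun n : ℕ => erdosRenyi n (p n) {ω | HasLegalSystem (graphOf ω)})
      atTop (nhds 1) := by
  obtain ⟨D, hD⟩ := core_exists
  have hlog : Tendsto (fun n : ℕ => Real.log n) atTop atTop :=
    Real.tendsto_log_atTop.comp tendsto_natCast_atTop_atTop
  have hb : Tendsto (fun n : ℕ => 1 - 13 * Real.exp (-(0.08 * Real.log n))) atTop (nhds 1) := by
    have h1 : Tendsto (fun n : ℕ => 0.08 * Real.log n) atTop atTop :=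
      hlog.const_mul_atTop (by norm_num)
    have h2 := (Real.tendsto_exp_neg_atTop_nhds_zero.comp h1).const_mul 13
    have h3 := h2.const_sub 1
    simpa using h3
  have hb' : Tendsto (fun n : ℕ => ENNReal.ofReal (1 - 13 * Real.exp (-(0.08 * Real.log n))))
      atTop (nhds 1) := by
    have := ENNReal.tendsto_ofReal hb
    simpa using this
  have hev : ∀ᶠ n : ℕ in atTop,
      ENNReal.ofReal (1 - 13 * Real.exp (-(0.08 * Real.log n))) ≤
        erdosRenyi n (p n) {ω | HasLegalSystem (graphOf ω)} ∧
      erdosRenyi n (p n) {ω | HasLegalSystem (graphOf ω)} ≤ 1 := by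
    filter_upwards [hp, hlog.eventually_ge_atTop D, hlog.eventually_ge_atTop 0,
      eventually_gt_atTop 0] with n h1 h2 h2' h3
    have hn : (0 : ℝ) < n := by exact_mod_cast h3
    have hp0 : 0 ≤ p n := le_trans (by positivity) h1.1
    have := er_prob n (p n) hp0 (by linarith [h1.2])
    refine ⟨?_, prob_le_one⟩
    have h4 := hD n (p n) h2 (by
      have := h1.1
      rwa [div_le_iff₀ hn] at this) h1.2
    have hm : MeasurableSet {ω : Sym2 (Fin n) → Bool | HasLegalSystem (graphOf ω)} :=
      (Set.toFinite _).measurableSet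
    have h5 := probReal_compl_eq_one_sub (μ := erdosRenyi n (p n)) hm
    have h6 : {ω : Sym2 (Fin n) → Bool | HasLegalSystem (graphOf ω)}ᶜ
        = {ω | ¬ HasLegalSystem (graphOf ω)} := rfl
    rw [h6] at h5
    rw [← ofReal_measureReal (measure_ne_top _ _)]
    apply ENNReal.ofReal_le_ofReal
    linarith
  exact tendsto_of_tendsto_of_tendsto_of_le_of_le' hb' tendsto_const_nhds
    (hev.mono fun _ h => h.1) (hev.mono fun _ h => h.2)
end
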